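/- arXiv:2310.10809 — 2 statements merged into one kernel-verified Lean document; each statement's English description precedes it below -/
import Mathlib

section
/- The stationary distributions π_exit and π_entrance are related as follows: for every set A ⊆ 𝒵^m, P_{π_entrance}(𝒳(σ_1) ∈ A) = P_{π_exit}(𝒳(0) ∈ A) = π_exit(A), and P_{π_exit}(𝒳(1) ∈ A) = P_{π_entrance}(𝒳(0) ∈ A) = π_entrance(A). -/
open MeasureTheory Filter
open scoped ENNReal

/-- `sigmaT ι ω = σ_{ι+1}(ω)`: the `(ι+1)`-st exit time of the radius from `ℕ`
along a trajectory `ω` in `ℤ × {1,…,m}`, i.e. `σ₁ = inf {k ≥ 0 : R(k) ≤ 0}`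
and `σ_{ι+1} = inf {k > σ_ι : R(k) ≤ 0}`. -/
noncomputable def sigmaT {m : ℕ} : ℕ → (ℕ → ℤ × Fin m) → ℕ
  | 0, ω => sInf {k : ℕ | (ω k).1 ≤ 0}
  | ι + 1, ω => sInf {k : ℕ | sigmaT ι ω < k ∧ (ω k).1 ≤ 0}

/-- The `n`-step transition probabilities of the kernel `K`. -/
noncomputable def iterK {m : ℕ} (K : ℤ × Fin m → PMF (ℤ × Fin m)) :
    ℕ → ℤ × Fin m → PMF (ℤ × Fin m)
  | 0, s => PMF.pure s
  | n + 1, s => (iterK K n s).bind K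

/-- `π` is a stationary distribution of the embedded exit chain
`𝒳_exit(ι) = 𝒳(σ_ι)`: a probability distribution on the state space
`{…,−1,0} × {1,…,m}` of that chain which is invariant under its transition
kernel (from an exit state `s` the next exit value is `ω(σ₂)` under `P s`). -/
def ExitStationary {m : ℕ} (P : ℤ × Fin m → Measure (ℕ → ℤ × Fin m))
    (π : Measure (ℤ × Fin m)) : Prop :=
  IsProbabilityMeasure π ∧ π {s : ℤ × Fin m | 1 ≤ s.1} = 0 ∧
  ∀ A : Set (ℤ × Fin m),
    ∑' s : ℤ × Fin m, π {s} * P s {ω | ω (sigmaT 1 ω) ∈ A} = π A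

/-- `π` is a stationary distribution of the embedded entrance chain
`𝒳_entrance(ι) = 𝒳(τ_ι) = 𝒳(σ_ι + 1)`: a probability distribution on the
state space `ℕ × {1,…,m}` of that chain which is invariant under its
transition kernel (from an entrance state `s` the next entrance value is
`ω(σ₁ + 1)` under `P s`). -/
def EntranceStationary {m : ℕ} (P : ℤ × Fin m → Measure (ℕ → ℤ × Fin m))
    (π : Measure (ℤ × Fin m)) : Prop :=
  IsProbabilityMeasure π ∧ π {s : ℤ × Fin m | s.1 ≤ 0} = 0 ∧
  ∀ A : Set (ℤ × Fin m),
    ∑' s : ℤ × Fin m, π {s} * P s {ω | ω (sigmaT 0 ω + 1) ∈ A} = π A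


/-- Bounded monotone function vanishing on nonpositives and harmonic on positives is zero. -/
lemma recur_zero (p h : ℤ → ℝ) (p0 : ∀ y, 0 ≤ p y) (ps : Summable p)
    (hint : Summable fun y : ℤ => |(y : ℝ)| * p y)
    (hmean : ∑' y : ℤ, (y : ℝ) * p y = 0)
    (y0 : ℤ) (hy0 : 1 ≤ y0) (hpy0 : p y0 ≠ 0)
    (h0 : ∀ x, 0 ≤ h x) (h1 : ∀ x, h x ≤ 1) (hmono : Monotone h)
    (hneg : ∀ x, x ≤ 0 → h x = 0) (p1 : ∑' y, p y = 1)
    (hharm : ∀ x, 1 ≤ x → h x = ∑' y, p y * h (x + y)) : ∀ x, h x = 0 := by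
  have hsum : ∀ x, Summable fun y => p y * h (x + y) := fun x =>
    Summable.of_nonneg_of_le (fun y => mul_nonneg (p0 y) (h0 _))
      (fun y => mul_le_of_le_one_right (p0 y) (h1 _)) ps
  obtain ⟨H, hH⟩ : ∃ H, Tendsto h atTop (nhds H) :=
    ⟨_, tendsto_atTop_ciSup hmono ⟨1, by rintro _ ⟨x, rfl⟩; exact h1 x⟩⟩
  -- truncated sums
  set S : ℕ → ℤ → ℝ := fun L y => ∑ k ∈ Finset.range (2 * L + 1),
    (h (-(L : ℤ) + k + y) - h (-(L : ℤ) + k)) with hS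
  have hstep : ∀ L y, S L (y + 1) - S L y = h ((L : ℤ) + 1 + y) - h (-(L : ℤ) + y) := by
    intro L y
    have := Finset.sum_range_sub (fun k : ℕ => h (-(L : ℤ) + k + y)) (2 * L + 1)
    simp only [hS]
    rw [← Finset.sum_sub_distrib]
    trans ∑ i ∈ Finset.range (2 * L + 1), (h (-(L : ℤ) + (i + 1 : ℕ) + y) - h (-(L : ℤ) + i + y))
    · apply Finset.sum_congr rfl
      intro i _
      have : -(L : ℤ) + i + (y + 1) = -(L : ℤ) + (i + 1 : ℕ) + y := by push_cast; ring
      rw [this]; ring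
    · rw [this]
      congr 2
      · push_cast; ring
      · push_cast; ring
  have hS0 : ∀ L, S L 0 = 0 := by intro L; simp [hS]
  have hd0 : ∀ (L : ℕ) y, 0 ≤ h ((L : ℤ) + 1 + y) - h (-(L : ℤ) + y) := fun L y =>
    sub_nonneg.2 (hmono (by omega))
  have hd1 : ∀ (L : ℕ) y, h ((L : ℤ) + 1 + y) - h (-(L : ℤ) + y) ≤ 1 := fun L y => by
    linarith [h1 ((L : ℤ) + 1 + y), h0 (-(L : ℤ) + y)]
  have hlim : ∀ y : ℤ, Tendsto (fun L : ℕ => h ((L : ℤ) + 1 + y) - h (-(L : ℤ) + y)) atTop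
      (nhds H) := by
    intro y
    have e1 : Tendsto (fun L : ℕ => h ((L : ℤ) + 1 + y)) atTop (nhds H) := by
      apply hH.comp
      have := tendsto_natCast_atTop_atTop (R := ℤ)
      simpa [add_assoc] using tendsto_atTop_add_const_right atTop (1 + y) this
    have e2 : Tendsto (fun L : ℕ => h (-(L : ℤ) + y)) atTop (nhds 0) := by
      apply tendsto_const_nhds.congr'
      filter_upwards [eventually_ge_atTop y.toNat] with L hL
      rw [hneg _ (by omega)]
    simpa using e1.sub e2
  have hSb : ∀ (L : ℕ) (y : ℤ), |S L y| ≤ |(y : ℝ)| := by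
    intro L y
    have key1 : ∀ n : ℕ, 0 ≤ S L n ∧ S L n ≤ n := by
      intro n
      induction n with
      | zero => simp [hS0]
      | succ n ih =>
        have := hstep L n; have := hd0 L n; have := hd1 L n
        push_cast
        constructor <;> linarith
    have key2 : ∀ n : ℕ, S L (-n) ≤ 0 ∧ -(n : ℝ) ≤ S L (-n) := by
      intro n
      induction n with
      | zero => simp [hS0]
      | succ n ih =>
        have h5 := hstep L (-(n + 1 : ℕ)); have := hd0 L (-(n + 1 : ℕ)); have := hd1 L (-(n + 1 : ℕ))
        have e : -((n + 1 : ℕ) : ℤ) + 1 = -n := by push_cast; ring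
        rw [e] at h5
        have e' : (((n + 1 : ℕ) : ℝ)) = n + 1 := by push_cast; ring
        rw [e']
        constructor <;> linarith
    obtain ⟨n, rfl | rfl⟩ := y.eq_nat_or_neg
    · rw [abs_of_nonneg (key1 n).1]; simpa using (key1 n).2
    · rw [abs_of_nonpos (key2 n).1]; have := (key2 n).2; simp; linarith
  have hSl : ∀ y : ℤ, Tendsto (fun L => S L y) atTop (nhds (y * H)) := by
    intro y
    induction y with
    | zero => simp [hS0]
    | succ n ih =>
      have := ih.add (hlim n)
      refine (this.congr ?_).trans (by push_cast; rw [add_mul, one_mul])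
      intro L; rw [← hstep]; ring
    | pred n ih =>
      have := ih.sub (hlim (-n - 1))
      refine (this.congr ?_).trans (by push_cast; rw [sub_mul, one_mul])
      intro L; rw [← hstep]; simp
  -- Tannery
  have hT : Tendsto (fun L => ∑' y, p y * S L y) atTop (nhds (∑' y : ℤ, p y * (y * H))) := by
    refine tendsto_tsum_of_dominated_convergence hint (fun y => (hSl y).const_mul _) ?_
    filter_upwards with L y
    rw [Real.norm_eq_abs, abs_mul, abs_of_nonneg (p0 y), mul_comm]
    exact mul_le_mul_of_nonneg_right (hSb L y) (p0 y)
  have hz : ∑' y : ℤ, p y * (y * H) = 0 := by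
    have : (fun y : ℤ => p y * (y * H)) = fun y : ℤ => (y * p y) * H := by ext y; ring
    rw [this, tsum_mul_right, hmean, zero_mul]
  rw [hz] at hT
  have hu : ∀ x, ∑' y, p y * (h (x + y) - h x) = (∑' y, p y * h (x + y)) - h x := by
    intro x
    simp only [mul_sub]
    rw [(hsum x).tsum_sub (ps.mul_right _), tsum_mul_right, p1, one_mul]
  have hus : ∀ x, Summable fun y => p y * (h (x + y) - h x) := by
    intro x; simp only [mul_sub]; exact (hsum x).sub (ps.mul_right _)
  have hlow : ∀ L, ∑' y, p y * h (0 + y) ≤ ∑' y, p y * S L y := by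
    intro L
    have e : ∑' y, p y * S L y = ∑ k ∈ Finset.range (2 * L + 1),
        ∑' y, p y * (h (-(L : ℤ) + k + y) - h (-(L : ℤ) + k)) := by
      rw [← Summable.tsum_finsetSum (fun i _ => hus _)]
      congr 1; ext y; rw [Finset.mul_sum]
    rw [e]
    have hnn : ∀ k ∈ Finset.range (2 * L + 1),
        0 ≤ ∑' y, p y * (h (-(L : ℤ) + k + y) - h (-(L : ℤ) + k)) := by
      intro k _
      rw [hu]
      by_cases hx : 1 ≤ -(L : ℤ) + k
      · rw [← hharm _ hx]; simp
      · rw [hneg _ (by omega : -(L : ℤ) + k ≤ 0), sub_zero]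
        exact tsum_nonneg fun y => mul_nonneg (p0 y) (h0 _)
    refine le_trans ?_ (Finset.single_le_sum hnn (Finset.mem_range.2 (by omega : L < 2 * L + 1)))
    rw [hu]
    simp [hneg 0 le_rfl]
  have hle : ∑' y, p y * h (0 + y) ≤ 0 := ge_of_tendsto hT (Eventually.of_forall hlow)
  have hstep2 : ∀ x, ∑' y, p y * h (x + y) ≤ 0 → h (x + y0) = 0 := by
    intro x hx
    have hnn : ∀ y, 0 ≤ p y * h (x + y) := fun y => mul_nonneg (p0 y) (h0 _)
    have := (hsum x).le_tsum y0 (fun y _ => hnn y)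
    have h3 := le_antisymm (this.trans hx) (hnn y0)
    exact (mul_eq_zero.1 h3).resolve_left hpy0
  have hiter : ∀ n : ℕ, h ((n + 1) * y0) = 0 := by
    intro n
    induction n with
    | zero => simpa using hstep2 0 hle
    | succ n ih =>
      have := hstep2 ((n + 1) * y0) (by rw [← hharm _ (by nlinarith), ih])
      rw [← this]; congr 1; push_cast; ring
  intro x
  apply le_antisymm _ (h0 x)
  rw [← hiter x.toNat]
  apply hmono
  have : x ≤ x.toNat := Int.self_le_toNat x
  nlinarith

lemma exists_pos_step (p : ℤ → ℝ) (p0 : ∀ y, 0 ≤ p y)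
    (hint : Summable fun y : ℤ => |(y : ℝ)| * p y)
    (hmean : ∑' y : ℤ, (y : ℝ) * p y = 0) (w : ℝ) (hw : 0 < w)
    (hvar : w ^ 2 = ∑' y : ℤ, (y : ℝ) ^ 2 * p y) : ∃ y0 : ℤ, 1 ≤ y0 ∧ p y0 ≠ 0 := by
  by_contra! hc
  have hs : Summable fun y : ℤ => -((y : ℝ) * p y) := by
    apply Summable.of_norm
    refine hint.congr fun y => ?_
    rw [norm_neg, norm_mul, Real.norm_eq_abs, Real.norm_eq_abs, abs_of_nonneg (p0 y)]
  have hnn : ∀ y : ℤ, 0 ≤ -((y : ℝ) * p y) := by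
    intro y
    by_cases hy : 1 ≤ y
    · simp [hc y hy]
    · have : (y : ℝ) ≤ 0 := by exact_mod_cast (by omega : y ≤ 0)
      nlinarith [p0 y]
  have h0 : HasSum (fun y : ℤ => -((y : ℝ) * p y)) 0 := by
    have := hs.hasSum
    rwa [tsum_neg, hmean, neg_zero] at this
  have h1 := (hasSum_zero_iff_of_nonneg hnn).1 h0
  have h2 : ∀ y : ℤ, (y : ℝ) ^ 2 * p y = 0 := by
    intro y
    have := congrFun h1 y
    simp only [Pi.zero_apply, neg_eq_zero] at this
    rw [pow_two, mul_assoc, this, mul_zero]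
  simp only [h2, tsum_zero] at hvar
  nlinarith

lemma ennreal_tsum_sub {S : Type*} {f g : S → ℝ≥0∞} (hg : ∑' s, g s ≠ ⊤) (h : ∀ s, g s ≤ f s) :
    ∑' s, (f s - g s) = ∑' s, f s - ∑' s, g s := by
  have e : ∑' s, (f s - g s) + ∑' s, g s = ∑' s, f s := by
    rw [← ENNReal.tsum_add]
    exact tsum_congr fun s => tsub_add_cancel_of_le (h s)
  rw [← e, ENNReal.add_sub_cancel_right hg]

lemma stat_unique {S : Type*} (F : S → S → ℝ≥0∞) (hF : ∀ s, ∑' u, F s u = 1)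
    (hirr : ∀ A B : Set S, A.Nonempty → B.Nonempty →
      (∀ s ∈ A, ∀ u, F s u ≠ 0 → u ∈ A) → (∀ s ∈ B, ∀ u, F s u ≠ 0 → u ∈ B) →
      (A ∩ B).Nonempty)
    (a b : S → ℝ≥0∞) (ha1 : ∑' s, a s = 1) (hb1 : ∑' s, b s = 1)
    (ha : ∀ u, ∑' s, a s * F s u = a u) (hb : ∀ u, ∑' s, b s * F s u = b u) : a = b := by
  set c : S → ℝ≥0∞ := fun s => min (a s) (b s) with hc
  have hmass : ∀ f : S → ℝ≥0∞, ∑' u, ∑' s, f s * F s u = ∑' s, f s := by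
    intro f
    rw [ENNReal.tsum_comm]
    simp [ENNReal.tsum_mul_left, hF]
  have hcle : ∀ u, ∑' s, c s * F s u ≤ c u := fun u => le_min
    ((ENNReal.tsum_le_tsum fun s => by gcongr; exact min_le_left _ _).trans (ha u).le)
    ((ENNReal.tsum_le_tsum fun s => by gcongr; exact min_le_right _ _).trans (hb u).le)
  have hcfin : ∑' s, c s ≠ ⊤ := ne_top_of_le_ne_top ENNReal.one_ne_top
    ((ENNReal.tsum_le_tsum fun s => min_le_left _ _).trans ha1.le)
  have hcst : ∀ u, ∑' s, c s * F s u = c u := by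
    have h := ennreal_tsum_sub (f := c) (g := fun u => ∑' s, c s * F s u)
      (by rw [hmass]; exact hcfin) hcle
    rw [hmass, tsub_self, ENNReal.tsum_eq_zero] at h
    exact fun u => le_antisymm (hcle u) (tsub_eq_zero_iff_le.1 (h u))
  -- residual part
  have hres : ∀ f : S → ℝ≥0∞, (∀ s, c s ≤ f s) → (∀ u, ∑' s, f s * F s u = f u) →
      ∀ s ∈ {s | f s - c s ≠ 0}, ∀ u, F s u ≠ 0 → u ∈ {s | f s - c s ≠ 0} := by
    intro f hcf hf s hs u hsu
    have hfin : ∑' s, c s * F s u ≠ ⊤ := by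
      rw [hcst]; exact ne_top_of_le_ne_top hcfin (ENNReal.le_tsum u)
    have e : f u - c u = ∑' s, (f s - c s) * F s u := by
      rw [← hf u, ← hcst u, ← ennreal_tsum_sub hfin (fun s => by gcongr; exact hcf s)]
      congr 1; ext s
      have hFt : F s u ≠ ⊤ := ne_top_of_le_ne_top ENNReal.one_ne_top
        ((ENNReal.le_tsum u).trans (hF s).le)
      rw [ENNReal.sub_mul (fun _ _ => hFt)]
    simp only [Set.mem_ofPred_eq, e]
    intro h
    rw [ENNReal.tsum_eq_zero] at h
    exact (mul_ne_zero hs hsu) (h s)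
  have hsubsum : ∀ f : S → ℝ≥0∞, (∀ s, c s ≤ f s) → ∑' s, (f s - c s) = ∑' s, f s - ∑' s, c s :=
    fun f hcf => ennreal_tsum_sub hcfin hcf
  have hca : ∀ s, c s ≤ a s := fun s => min_le_left _ _
  have hcb : ∀ s, c s ≤ b s := fun s => min_le_right _ _
  by_cases hne : (1 : ℝ≥0∞) - ∑' s, c s = 0
  · have e1 := hsubsum a hca
    have e2 := hsubsum b hcb
    rw [ha1, hne, ENNReal.tsum_eq_zero] at e1
    rw [hb1, hne, ENNReal.tsum_eq_zero] at e2
    ext s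
    rw [le_antisymm (tsub_eq_zero_iff_le.1 (e1 s)) (hca s),
      le_antisymm (tsub_eq_zero_iff_le.1 (e2 s)) (hcb s)]
  · exfalso
    have e1 := hsubsum a hca
    have e2 := hsubsum b hcb
    rw [ha1] at e1; rw [hb1] at e2
    obtain ⟨s, hs1, hs2⟩ := hirr {s | a s - c s ≠ 0} {s | b s - c s ≠ 0}
      (by by_contra! h
          apply hne; rw [← e1, ENNReal.tsum_eq_zero]; intro s
          by_contra h'
          exact (Set.eq_empty_iff_forall_notMem.1 h) s h')
      (by by_contra! h
          apply hne; rw [← e2, ENNReal.tsum_eq_zero]; intro s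
          by_contra h'
          exact (Set.eq_empty_iff_forall_notMem.1 h) s h')
      (hres a hca ha) (hres b hcb hb)
    rcases le_total (a s) (b s) with h | h
    · exact hs1 (by simp [hc, h])
    · exact hs2 (by simp [hc, h])

section Markov

/-- time shift -/
def shiftT {S : Type*} (ω : ℕ → S) : ℕ → S := fun k => ω (k + 1)

lemma measurable_shiftT {S : Type*} [MeasurableSpace S] : Measurable (shiftT (S := S)) :=
  measurable_pi_lambda _ fun k => measurable_pi_apply (k + 1)

/-- cylinder sets -/
def cylT {S : Type*} (n : ℕ) (path : ℕ → S) : Set (ℕ → S) := {ω | ∀ k ≤ n, ω k = path k}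

lemma mem_cylT {S : Type*} (n : ℕ) (path ω : ℕ → S) : ω ∈ cylT n path ↔ ∀ k ≤ n, ω k = path k :=
  Iff.rfl

lemma cylT_measurable {S : Type*} [MeasurableSpace S] [DiscreteMeasurableSpace S]
    (n : ℕ) (path : ℕ → S) : MeasurableSet (cylT n path) := by
  have : cylT n path = ⋂ k : ℕ, ⋂ _ : k ≤ n, (fun ω : ℕ → S => ω k) ⁻¹' {path k} := by
    ext ω; simp [mem_cylT]
  rw [this]
  exact MeasurableSet.iInter fun k => MeasurableSet.iInter fun _ =>
    measurable_pi_apply k (MeasurableSet.of_discrete)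

lemma generate_cylT {S : Type*} [MeasurableSpace S] [DiscreteMeasurableSpace S] [Countable S]
    [Inhabited S] :
    (MeasurableSpace.pi : MeasurableSpace (ℕ → S)) =
      MeasurableSpace.generateFrom {B | ∃ n path, B = cylT n path} := by
  apply le_antisymm
  · refine iSup_le fun k => ?_
    rintro _ ⟨A, -, rfl⟩
    have : (fun ω : ℕ → S => ω k) ⁻¹' A = ⋃ p : Fin (k + 1) → S, ⋃ _ : p (Fin.last k) ∈ A,
        cylT k (fun j => if h : j < k + 1 then p ⟨j, h⟩ else default) := by
      ext ω
      simp only [Set.mem_preimage, Set.mem_iUnion, mem_cylT, exists_prop]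
      constructor
      · intro h
        refine ⟨fun j => ω j, by simpa using h, fun j hj => ?_⟩
        rw [dif_pos (by omega)]
      · rintro ⟨p, hp, h⟩
        have := h k le_rfl
        rw [dif_pos (by omega)] at this
        rw [this]; exact hp
    rw [this]
    exact MeasurableSet.iUnion fun p => MeasurableSet.iUnion fun _ =>
      MeasurableSpace.measurableSet_generateFrom ⟨_, _, rfl⟩
  · apply MeasurableSpace.generateFrom_le
    rintro _ ⟨n, path, rfl⟩
    exact cylT_measurable n path

lemma pi_cylT {S : Type*} : IsPiSystem {B : Set (ℕ → S) | ∃ n path, B = cylT n path} := by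
  rintro _ ⟨n, p, rfl⟩ _ ⟨n', p', rfl⟩ ⟨w, hw, hw'⟩
  refine ⟨max n n', w, ?_⟩
  rw [mem_cylT] at hw hw'
  ext ω
  simp only [Set.mem_inter_iff, mem_cylT]
  constructor
  · rintro ⟨h, h'⟩ k hk
    rcases le_max_iff.1 hk with hk | hk
    · rw [h k hk, hw k hk]
    · rw [h' k hk, hw' k hk]
  · intro h
    exact ⟨fun k hk => by rw [h k (hk.trans (le_max_left _ _)), hw k hk],
      fun k hk => by rw [h k (hk.trans (le_max_right _ _)), hw' k hk]⟩

variable {S : Type*} [MeasurableSpace S] [DiscreteMeasurableSpace S] [Countable S] [Inhabited S]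
  [DecidableEq S] (K : S → PMF S) (P : S → Measure (ℕ → S)) (hprob : ∀ s, IsProbabilityMeasure (P s))
    (hcyl : ∀ (s : S) (n : ℕ) (path : ℕ → S),
      P s {ω | ∀ k ≤ n, ω k = path k} =
        (if path 0 = s then 1 else 0) *
          ∏ k ∈ Finset.range n, K (path k) (path (k + 1)))

include hprob hcyl in
lemma start_ae (s : S) : ∀ᵐ ω ∂(P s), ω 0 = s := by
  have h := hcyl s 0 (fun _ => s)
  simp only [if_true, Finset.range_zero, Finset.prod_empty, mul_one] at h
  have := hprob s
  change P s (cylT 0 (fun _ => s)) = 1 at h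
  rw [← prob_compl_eq_zero_iff (cylT_measurable 0 (fun _ => s))] at h
  filter_upwards [compl_mem_ae_iff.2 h] with ω hω
  rw [compl_compl] at hω
  exact hω 0 le_rfl

include hprob hcyl in
lemma markov_shift (s : S) (B : Set (ℕ → S)) (hB : MeasurableSet B) :
    P s (shiftT ⁻¹' B) = ∑' t, K s t * P t B := by
  have := hprob s
  set ν : Measure (ℕ → S) := Measure.sum (fun t => K s t • P t) with hν
  have hνa : ∀ B, MeasurableSet B → ν B = ∑' t, K s t * P t B := by
    intro B hB
    rw [hν, Measure.sum_apply _ hB]; simp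
  have hmap : (P s).map shiftT = ν := by
    have : IsProbabilityMeasure ((P s).map shiftT) :=
      Measure.isProbabilityMeasure_map measurable_shiftT.aemeasurable
    refine ext_of_generate_finite _ generate_cylT pi_cylT ?_ ?_
    · rintro _ ⟨n, p, rfl⟩
      rw [Measure.map_apply measurable_shiftT (cylT_measurable n p), hνa _ (cylT_measurable n p)]
      have e : P s (shiftT ⁻¹' cylT n p) =
          P s {ω | ∀ k ≤ n + 1, ω k = (fun k => Nat.casesOn k s p : ℕ → S) k} := by
        apply measure_congr
        filter_upwards [start_ae K P hprob hcyl s] with ω hω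
        apply propext
        change (∀ k ≤ n, ω (k + 1) = p k) ↔ _
        constructor
        · intro h k hk
          cases k with
          | zero => exact hω
          | succ k => exact h k (by omega)
        · intro h k hk
          exact h (k + 1) (by omega)
      rw [e, hcyl, tsum_eq_single (p 0)]
      · unfold cylT
        rw [hcyl, Finset.prod_range_succ']
        simp [mul_comm]
      · intro t ht
        unfold cylT
        rw [hcyl]; simp [ht.symm]
    · rw [measure_univ, hνa _ MeasurableSet.univ]
      have : ∀ t, P t Set.univ = 1 := fun t => (hprob t).measure_univ
      simp [this, (K s).tsum_coe]
  rw [← Measure.map_apply measurable_shiftT hB, hmap, hνa _ hB]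

include hprob hcyl in
lemma one_step (s : S) (A : Set S) : P s {ω | ω 1 ∈ A} = ∑' t, K s t * A.indicator 1 t := by
  have hm : MeasurableSet {ω : ℕ → S | ω 0 ∈ A} := measurable_pi_apply 0 (MeasurableSet.of_discrete)
  have := markov_shift K P hprob hcyl s {ω | ω 0 ∈ A} hm
  change P s {ω | ω 1 ∈ A} = _ at this
  rw [this]
  congr 1; ext t
  congr 1
  have := hprob t
  by_cases ht : t ∈ A
  · rw [Set.indicator_of_mem ht, Pi.one_apply]
    apply (prob_compl_eq_zero_iff hm).1
    rw [← compl_mem_ae_iff, compl_compl]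
    filter_upwards [start_ae K P hprob hcyl t] with ω hω
    simpa [hω] using ht
  · rw [Set.indicator_of_notMem ht, ← compl_mem_ae_iff]
    filter_upwards [start_ae K P hprob hcyl t] with ω hω
    simpa [hω] using ht

include hprob hcyl in
lemma one_step_single (s t : S) : P s {ω | ω 1 = t} = K s t := by
  have := one_step K P hprob hcyl s {t}
  simp only [Set.mem_singleton_iff] at this
  rw [this, tsum_eq_single t]
  · simp
  · intro u hu; simp [hu]

/-- first exit from the complement of `N` occurs at time `n` in `A` (and next state in `B`) -/
def firstEx (N A B : Set S) (n : ℕ) : Set (ℕ → S) :=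
  {ω | (∀ k < n, ω k ∉ N) ∧ ω n ∈ N ∧ ω n ∈ A ∧ ω (n + 1) ∈ B}

omit [MeasurableSpace S] [DiscreteMeasurableSpace S] [Countable S] [Inhabited S] [DecidableEq S] in
lemma mem_firstEx (N A B : Set S) (n : ℕ) (ω : ℕ → S) : ω ∈ firstEx N A B n ↔
  (∀ k < n, ω k ∉ N) ∧ ω n ∈ N ∧ ω n ∈ A ∧ ω (n + 1) ∈ B := Iff.rfl

omit [Countable S] [Inhabited S] [DecidableEq S] in
lemma firstEx_meas (N A B : Set S) (n : ℕ) : MeasurableSet (firstEx N A B n) := by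
  have hm : ∀ (k : ℕ) (A : Set S), MeasurableSet {ω : ℕ → S | ω k ∈ A} := fun k A =>
    measurable_pi_apply k (MeasurableSet.of_discrete)
  have : firstEx N A B n = (⋂ k : ℕ, ⋂ _ : k < n, {ω : ℕ → S | ω k ∈ Nᶜ}) ∩
      ({ω | ω n ∈ N} ∩ ({ω | ω n ∈ A} ∩ {ω | ω (n + 1) ∈ B})) := by
    ext ω; simp [mem_firstEx]
  rw [this]
  exact (MeasurableSet.iInter fun k => MeasurableSet.iInter fun _ => hm _ _).inter
    ((hm _ _).inter ((hm _ _).inter (hm _ _)))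

include hprob hcyl in
lemma firstEx_markov (N B : Set S) (u : S) (n : ℕ) : ∀ s : S,
    P s (firstEx N {u} B n) = P s (firstEx N {u} Set.univ n) * P u {ω | ω 1 ∈ B} := by
  induction n with
  | zero =>
    intro s
    have hs := start_ae K P hprob hcyl s
    by_cases h : s = u ∧ s ∈ N
    · obtain ⟨rfl, hN⟩ := h
      have e1 : P s (firstEx N {s} B 0) = P s {ω | ω 1 ∈ B} := by
        apply measure_congr
        filter_upwards [hs] with ω hω
        apply propext
        change ((∀ k < 0, ω k ∉ N) ∧ ω 0 ∈ N ∧ ω 0 ∈ ({s} : Set S) ∧ ω (0 + 1) ∈ B) ↔ ω 1 ∈ B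
        simp [hω, hN]
      have e2 : P s (firstEx N {s} Set.univ 0) = P s Set.univ := by
        apply measure_congr
        filter_upwards [hs] with ω hω
        apply propext
        change ((∀ k < 0, ω k ∉ N) ∧ ω 0 ∈ N ∧ ω 0 ∈ ({s} : Set S) ∧ ω (0 + 1) ∈ Set.univ) ↔ True
        simp [hω, hN]
      rw [e1, e2, (hprob s).measure_univ, one_mul]
    · have e : ∀ B : Set S, P s (firstEx N {u} B 0) = 0 := by
        intro B
        rw [← compl_mem_ae_iff]
        filter_upwards [hs] with ω hω
        rw [Set.mem_compl_iff, mem_firstEx, hω]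
        rintro ⟨-, h1, h2, -⟩
        exact h ⟨h2, h1⟩
      rw [e, e, zero_mul]
  | succ n ih =>
    intro s
    have hs := start_ae K P hprob hcyl s
    by_cases h : s ∈ N
    · have e : ∀ B : Set S, P s (firstEx N {u} B (n + 1)) = 0 := by
        intro B
        rw [← compl_mem_ae_iff]
        filter_upwards [hs] with ω hω
        rw [Set.mem_compl_iff, mem_firstEx]
        rintro ⟨h1, -⟩
        exact h1 0 (by omega) (by rwa [hω])
      rw [e, e, zero_mul]
    · have e : ∀ B : Set S, P s (firstEx N {u} B (n + 1)) =
          ∑' t, K s t * P t (firstEx N {u} B n) := by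
        intro B
        rw [← markov_shift K P hprob hcyl s _ (firstEx_meas N {u} B n)]
        apply measure_congr
        filter_upwards [hs] with ω hω
        apply propext
        change ((∀ k < n + 1, ω k ∉ N) ∧ ω (n + 1) ∈ N ∧ ω (n + 1) ∈ ({u} : Set S) ∧
          ω (n + 1 + 1) ∈ B) ↔ ((∀ k < n, ω (k + 1) ∉ N) ∧ ω (n + 1) ∈ N ∧
          ω (n + 1) ∈ ({u} : Set S) ∧ ω (n + 1 + 1) ∈ B)
        refine and_congr_left fun _ => ⟨fun h k hk => h _ (by omega), fun h' k hk => ?_⟩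
        cases k with
        | zero => rwa [hω]
        | succ k => exact h' k (by omega)
      rw [e, e, ← ENNReal.tsum_mul_right]
      congr 1; ext t
      rw [ih t, mul_assoc]

/-- first exit in `A`, next state in `B`. -/
def exitEv (N A B : Set S) : Set (ℕ → S) := ⋃ n, firstEx N A B n

omit [Countable S] [Inhabited S] [DecidableEq S] in
lemma exitEv_meas (N A B : Set S) : MeasurableSet (exitEv N A B) :=
  MeasurableSet.iUnion fun n => firstEx_meas N A B n

omit [MeasurableSpace S] [DiscreteMeasurableSpace S] [Countable S] [Inhabited S] [DecidableEq S] in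
lemma firstEx_unique {N A B A' B' : Set S} {n n' : ℕ} {ω : ℕ → S} (h : ω ∈ firstEx N A B n)
    (h' : ω ∈ firstEx N A' B' n') : n = n' := by
  rw [mem_firstEx] at h h'
  rcases lt_trichotomy n n' with hl | hl | hl
  · exact absurd h.2.1 (h'.1 _ hl)
  · exact hl
  · exact absurd h'.2.1 (h.1 _ hl)

omit [Inhabited S] [DecidableEq S] in
lemma exitEv_split (N A B : Set S) (s : S) :
    P s (exitEv N A B) = ∑' u, A.indicator (fun u => P s (exitEv N {u} B)) u := by
  classical
  have e : exitEv N A B = ⋃ u : S, {ω | u ∈ A ∧ ω ∈ exitEv N {u} B} := by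
    ext ω
    simp only [exitEv, Set.mem_iUnion, Set.mem_ofPred_eq, mem_firstEx, Set.mem_singleton_iff]
    constructor
    · rintro ⟨n, h1, h2, h3, h4⟩
      exact ⟨ω n, h3, n, h1, h2, rfl, h4⟩
    · rintro ⟨u, hu, n, h1, h2, rfl, h4⟩
      exact ⟨n, h1, h2, hu, h4⟩
  have e' : ∀ u, {ω | u ∈ A ∧ ω ∈ exitEv N {u} B} = if u ∈ A then exitEv N {u} B else ∅ := by
    intro u
    by_cases hu : u ∈ A
    · simp [hu]
    · simp [hu]
  rw [e, measure_iUnion]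
  · congr 1; ext u
    rw [e']
    by_cases hu : u ∈ A <;> simp [hu]
  · intro u u' huu
    rw [Function.onFun, Set.disjoint_left]
    rintro ω ⟨_, h1⟩ ⟨_, h2⟩
    obtain ⟨n, h1⟩ := Set.mem_iUnion.1 h1
    obtain ⟨n', h2⟩ := Set.mem_iUnion.1 h2
    obtain rfl := firstEx_unique h1 h2
    exact huu (h1.2.2.1.symm.trans h2.2.2.1)
  · intro u
    rw [e']
    split_ifs
    · exact exitEv_meas _ _ _
    · exact MeasurableSet.empty

include hprob hcyl in
lemma exitEv_markov (N B : Set S) (u s : S) :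
    P s (exitEv N {u} B) = P s (exitEv N {u} Set.univ) * P u {ω | ω 1 ∈ B} := by
  have e : ∀ B, P s (exitEv N {u} B) = ∑' n, P s (firstEx N {u} B n) := by
    intro B
    refine measure_iUnion ?_ (fun n => firstEx_meas _ _ _ _)
    intro n n' hn
    rw [Function.onFun, Set.disjoint_left]
    intro ω h1 h2
    exact hn (firstEx_unique h1 h2)
  rw [e, e, ← ENNReal.tsum_mul_right]
  congr 1; ext n
  exact firstEx_markov K P hprob hcyl N B u n s

include hprob hcyl in
lemma exitEv_first_step (N A : Set S) (s : S) (hs : s ∉ N) :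
    P s (exitEv N A Set.univ) = ∑' t, K s t * P t (exitEv N A Set.univ) := by
  rw [← markov_shift K P hprob hcyl s _ (exitEv_meas _ _ _)]
  apply measure_congr
  filter_upwards [start_ae K P hprob hcyl s] with ω hω
  apply propext
  change ω ∈ exitEv N A Set.univ ↔ shiftT ω ∈ exitEv N A Set.univ
  simp only [exitEv, Set.mem_iUnion, mem_firstEx, shiftT, Set.mem_univ, and_true]
  constructor
  · rintro ⟨n, h1, h2, h3⟩
    cases n with
    | zero => rw [hω] at h2; exact absurd h2 hs
    | succ n => exact ⟨n, fun k hk => h1 _ (by omega), h2, h3⟩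
  · rintro ⟨n, h1, h2, h3⟩
    refine ⟨n + 1, fun k hk => ?_, h2, h3⟩
    cases k with
    | zero => rwa [hω]
    | succ k => exact h1 k (by omega)

include hprob hcyl in
lemma exitEv_start (N : Set S) (s : S) (hs : s ∈ N) :
    P s (exitEv N {s} Set.univ) = 1 := by
  rw [← (hprob s).measure_univ]
  apply measure_congr
  filter_upwards [start_ae K P hprob hcyl s] with ω hω
  apply propext
  change ω ∈ exitEv N {s} Set.univ ↔ True
  simp only [exitEv, Set.mem_iUnion, mem_firstEx, Set.mem_univ, and_true, iff_true]
  exact ⟨0, by simp, by rwa [hω], hω⟩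

/-- staying outside `N` up to time `n` -/
def stay (N : Set S) (n : ℕ) : Set (ℕ → S) := {ω | ∀ k ≤ n, ω k ∉ N}

omit [Countable S] [Inhabited S] [DecidableEq S] in
lemma stay_meas (N : Set S) (n : ℕ) : MeasurableSet (stay N n) := by
  have : stay N n = ⋂ k : ℕ, ⋂ _ : k ≤ n, (fun ω : ℕ → S => ω k) ⁻¹' Nᶜ := by
    ext ω; simp [stay]
  rw [this]
  exact MeasurableSet.iInter fun k => MeasurableSet.iInter fun _ =>
    measurable_pi_apply k (MeasurableSet.of_discrete)

include hprob hcyl in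
lemma stay_succ (N : Set S) (n : ℕ) (s : S) (hs : s ∉ N) :
    P s (stay N (n + 1)) = ∑' t, K s t * P t (stay N n) := by
  rw [← markov_shift K P hprob hcyl s _ (stay_meas _ _)]
  apply measure_congr
  filter_upwards [start_ae K P hprob hcyl s] with ω hω
  apply propext
  change (∀ k ≤ n + 1, ω k ∉ N) ↔ (∀ k ≤ n, ω (k + 1) ∉ N)
  refine ⟨fun h k hk => h _ (by omega), fun h k hk => ?_⟩
  cases k with
  | zero => rwa [hω]
  | succ k => exact h k (by omega)

include hprob hcyl in
lemma stay_in (N : Set S) (n : ℕ) (s : S) (hs : s ∈ N) : P s (stay N n) = 0 := by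
  rw [← compl_mem_ae_iff]
  filter_upwards [start_ae K P hprob hcyl s] with ω hω
  intro h
  exact h 0 (by omega) (by rwa [hω])

include hprob hcyl in
lemma stay_zero (N : Set S) (s : S) (hs : s ∉ N) : P s (stay N 0) = 1 := by
  rw [← (hprob s).measure_univ]
  apply measure_congr
  filter_upwards [start_ae K P hprob hcyl s] with ω hω
  apply propext
  change (∀ k ≤ 0, ω k ∉ N) ↔ True
  simp [hω, hs]

include hprob hcyl in
lemma never_step (N : Set S) (s : S) (hs : s ∉ N) :
    P s (⋂ n, stay N n) = ∑' t, K s t * P t (⋂ n, stay N n) := by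
  rw [← markov_shift K P hprob hcyl s _ (MeasurableSet.iInter fun n => stay_meas _ _)]
  apply measure_congr
  filter_upwards [start_ae K P hprob hcyl s] with ω hω
  apply propext
  change ω ∈ (⋂ n, stay N n) ↔ shiftT ω ∈ (⋂ n, stay N n)
  simp only [Set.mem_iInter]
  change (∀ n, ∀ k ≤ n, ω k ∉ N) ↔ (∀ n, ∀ k ≤ n, ω (k + 1) ∉ N)
  refine ⟨fun h n k hk => h (n + 1) _ (by omega), fun h n k hk => ?_⟩
  cases k with
  | zero => rwa [hω]
  | succ k => exact h n k (by omega)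

end Markov

/-- Nonpositive radius. -/
def negS (m : ℕ) : Set (ℤ × Fin m) := {s | s.1 ≤ 0}

lemma mem_negS {m : ℕ} (s : ℤ × Fin m) : s ∈ negS m ↔ s.1 ≤ 0 := Iff.rfl

lemma kernel_sum {m : ℕ} (κ : PMF (ℤ × Fin m)) (p : PMF ℤ) (x : ℤ) (i : Fin m)
    (h : ∀ y, κ (x + y, i) = p y) (f : ℤ × Fin m → ℝ≥0∞) :
    ∑' t, κ t * f t = ∑' y, p y * f (x + y, i) := by
  set g : ℤ → ℤ × Fin m := fun y => (x + y, i) with hg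
  have hinj : Function.Injective g := by
    intro a b hab
    simpa [hg] using hab
  have h1 : ∑' t : Set.range g, κ t = 1 := by
    rw [tsum_range (fun t => κ t) hinj]
    simp only [hg, h, p.tsum_coe]
  have h2 := ENNReal.summable.tsum_add_tsum_compl (s := Set.range g) (f := fun t => κ t)
    ENNReal.summable
  rw [h1, κ.tsum_coe] at h2
  have h3 : ∑' t : ↑(Set.range g)ᶜ, κ t = 0 := by
    have : (1 : ℝ≥0∞) + ∑' t : ↑(Set.range g)ᶜ, κ t = 1 + 0 := by rw [h2, add_zero]
    exact (ENNReal.add_right_inj ENNReal.one_ne_top).1 this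
  rw [ENNReal.tsum_eq_zero] at h3
  have hsupp : Function.support (fun t => κ t * f t) ⊆ Set.range g := by
    intro t ht
    by_contra hc
    exact ht (by simp [h3 ⟨t, hc⟩])
  rw [← hinj.tsum_eq hsupp]
  simp only [hg, h]

lemma never_zero
    (m : ℕ) (K : ℤ × Fin m → PMF (ℤ × Fin m))
    (P : ℤ × Fin m → Measure (ℕ → ℤ × Fin m))
    (hprob : ∀ s, IsProbabilityMeasure (P s))
    (hcyl : ∀ (s : ℤ × Fin m) (n : ℕ) (path : ℕ → ℤ × Fin m),
      P s {ω | ∀ k ≤ n, ω k = path k} =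
        (if path 0 = s then 1 else 0) *
          ∏ k ∈ Finset.range n, K (path k) (path (k + 1)))
    (ξ : Fin m → PMF ℤ) (v : Fin m → ℝ) (hv : ∀ i, 0 < v i)
    (hA1 : ∀ x : ℤ, 1 ≤ x → ∀ (i : Fin m) (y : ℤ), K (x, i) (x + y, i) = ξ i y)
    (hint : ∀ i, Summable fun y : ℤ => |(y : ℝ)| * (ξ i y).toReal)
    (hmean : ∀ i, ∑' y : ℤ, (y : ℝ) * (ξ i y).toReal = 0)
    (hvar : ∀ i, (v i) ^ 2 = ∑' y : ℤ, (y : ℝ) ^ 2 * (ξ i y).toReal)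
    (s : ℤ × Fin m) : P s (⋂ n, stay (negS m) n) = 0 := by
  obtain ⟨x, i⟩ := s
  have : Inhabited (ℤ × Fin m) := ⟨(x, i)⟩
  have hmn : ∀ n, Monotone fun x : ℤ => P (x, i) (stay (negS m) n) := by
    intro n
    induction n with
    | zero =>
      intro x y hxy
      by_cases hx : x ≤ 0
      · simp only
        rw [stay_in K P hprob hcyl _ _ (x, i) hx]; exact zero_le
      · simp only
        rw [stay_zero K P hprob hcyl _ (x, i) hx,
          stay_zero K P hprob hcyl _ (y, i) (fun h => hx (hxy.trans h))]
    | succ n ih =>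
      intro x y hxy
      by_cases hx : x ≤ 0
      · simp only
        rw [stay_in K P hprob hcyl _ _ (x, i) hx]; exact zero_le
      · simp only
        rw [stay_succ K P hprob hcyl _ _ (x, i) hx,
          stay_succ K P hprob hcyl _ _ (y, i) (fun h => hx (hxy.trans h)),
          kernel_sum _ (ξ i) x i (hA1 x (by omega) i),
          kernel_sum _ (ξ i) y i (hA1 y (by omega) i)]
        refine ENNReal.tsum_le_tsum fun z => ?_
        exact mul_le_mul_right (ih (by omega : x + z ≤ y + z)) _
  have hanti : Antitone (stay (negS m)) := fun a b hab ω hω k hk => hω k (hk.trans hab)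
  have hPI : ∀ s, P s (⋂ n, stay (negS m) n) = ⨅ n, P s (stay (negS m) n) := by
    intro s
    have := hprob s
    exact hanti.measure_iInter (fun n => (stay_meas _ _).nullMeasurableSet)
      ⟨0, measure_ne_top _ _⟩
  have hm : Monotone fun x : ℤ => P (x, i) (⋂ n, stay (negS m) n) := by
    intro x y hxy
    simp only [hPI]
    exact iInf_mono fun n => hmn n hxy
  have hle1 : ∀ s, P s (⋂ n, stay (negS m) n) ≤ 1 := fun s => by
    have := hprob s
    exact prob_le_one
  have hfin : ∀ s, P s (⋂ n, stay (negS m) n) ≠ ⊤ := fun s =>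
    ne_top_of_le_ne_top ENNReal.one_ne_top (hle1 s)
  have hξfin : ∀ y, ξ i y ≠ ⊤ := fun y => (ξ i).apply_ne_top y
  obtain ⟨y0, hy0, hpy0⟩ := exists_pos_step (fun y => (ξ i y).toReal)
    (fun _ => ENNReal.toReal_nonneg) (hint i) (hmean i) (v i) (hv i) (hvar i)
  have key := recur_zero (fun y => (ξ i y).toReal)
    (fun x => (P (x, i) (⋂ n, stay (negS m) n)).toReal) (fun _ => ENNReal.toReal_nonneg)
    (ENNReal.summable_toReal (by rw [(ξ i).tsum_coe]; exact ENNReal.one_ne_top))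
    (hint i) (hmean i) y0 hy0 hpy0 (fun _ => ENNReal.toReal_nonneg)
    (fun x => ENNReal.toReal_le_of_le_ofReal zero_le_one (by simpa using hle1 (x, i)))
    (fun x y hxy => ENNReal.toReal_mono (hfin _) (hm hxy))
    (fun x hx => by
      have : P (x, i) (⋂ n, stay (negS m) n) = 0 :=
        measure_mono_null (Set.iInter_subset _ 0) (stay_in K P hprob hcyl _ 0 (x, i) hx)
      simp only [this, ENNReal.toReal_zero])
    (by rw [← ENNReal.tsum_toReal_eq hξfin, (ξ i).tsum_coe, ENNReal.toReal_one])
    (fun x hx => by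
      rw [never_step K P hprob hcyl _ (x, i) (fun h => by have : x ≤ 0 := h; omega),
        kernel_sum _ (ξ i) x i (hA1 x hx i),
        ENNReal.tsum_toReal_eq (fun y => ENNReal.mul_ne_top (hξfin y) (hfin _))]
      simp only [ENNReal.toReal_mul])
  have := key x
  exact ((ENNReal.toReal_eq_zero_iff _).1 this).resolve_right (hfin _)

/-- deterministic description of the first exit time -/
lemma sigma0_eq {m : ℕ} (ω : ℕ → ℤ × Fin m) (n : ℕ) (h1 : ∀ k < n, ω k ∉ negS m)
    (h2 : ω n ∈ negS m) : sigmaT 0 ω = n := by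
  rw [sigmaT]
  apply le_antisymm
  · exact Nat.sInf_le h2
  · by_contra! hc
    have := Nat.sInf_mem (s := {k : ℕ | (ω k).1 ≤ 0}) ⟨n, h2⟩
    exact h1 _ hc this

lemma exists_first {m : ℕ} (ω : ℕ → ℤ × Fin m) (h : ω ∉ ⋂ n, stay (negS m) n) :
    ∃ n, (∀ k < n, ω k ∉ negS m) ∧ ω n ∈ negS m := by
  classical
  have : ∃ n, ω n ∈ negS m := by
    by_contra! hc
    exact h (Set.mem_iInter.2 fun n k _ => hc k)
  exact ⟨Nat.find this, fun k hk => Nat.find_min this hk, Nat.find_spec this⟩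

lemma sigma1_eq {m : ℕ} (ω : ℕ → ℤ × Fin m) (n : ℕ) (h0 : ω 0 ∈ negS m)
    (h1 : ∀ k < n, ω (k + 1) ∉ negS m) (h2 : ω (n + 1) ∈ negS m) : sigmaT 1 ω = n + 1 := by
  have e0 : sigmaT 0 ω = 0 := sigma0_eq ω 0 (by simp) h0
  rw [sigmaT, e0]
  have hmem : n + 1 ∈ {k : ℕ | 0 < k ∧ (ω k).1 ≤ 0} := ⟨by omega, h2⟩
  apply le_antisymm
  · exact Nat.sInf_le hmem
  · by_contra! hc
    have hh := Nat.sInf_mem (s := {k : ℕ | 0 < k ∧ (ω k).1 ≤ 0}) ⟨_, hmem⟩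
    obtain ⟨k, hk⟩ := Nat.exists_eq_succ_of_ne_zero hh.1.ne'
    rw [hk] at hh hc
    exact h1 k (by omega) hh.2

lemma mem_exitEv_iff {m : ℕ} (ω : ℕ → ℤ × Fin m) (n : ℕ) (h1 : ∀ k < n, ω k ∉ negS m)
    (h2 : ω n ∈ negS m) (A B : Set (ℤ × Fin m)) :
    ω ∈ exitEv (negS m) A B ↔ ω n ∈ A ∧ ω (n + 1) ∈ B := by
  constructor
  · intro h
    obtain ⟨n', h⟩ := Set.mem_iUnion.1 h
    have h' : ω ∈ firstEx (negS m) Set.univ Set.univ n := ⟨h1, h2, trivial, trivial⟩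
    obtain rfl := firstEx_unique h h'
    exact h.2.2
  · intro h
    exact Set.mem_iUnion.2 ⟨n, h1, h2, h.1, h.2⟩
/-- The stationary exit and entrance distributions are intertwined:
starting from `π_entrance`, the law of `𝒳(σ₁)` is `π_exit`, and starting
from `π_exit`, the law of `𝒳(1)` is `π_entrance`. -/
theorem stmt_2
    (m : ℕ) (hm : 1 ≤ m)
    (K : ℤ × Fin m → PMF (ℤ × Fin m))
    (P : ℤ × Fin m → Measure (ℕ → ℤ × Fin m))
    (hprob : ∀ s, IsProbabilityMeasure (P s))
    -- `P s` is the law of the Markov chain with kernel `K` started at `s`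
    (hcyl : ∀ (s : ℤ × Fin m) (n : ℕ) (path : ℕ → ℤ × Fin m),
      P s {ω | ∀ k ≤ n, ω k = path k} =
        (if path 0 = s then 1 else 0) *
          ∏ k ∈ Finset.range n, K (path k) (path (k + 1)))
    -- (A1): on `ℕ × {i}` the radius jumps like a centered square-integrable
    -- 1-arithmetic random walk with step distribution `ξ i`, variance `(v i)²`
    (ξ : Fin m → PMF ℤ) (v : Fin m → ℝ) (hv : ∀ i, 0 < v i)
    (hA1 : ∀ x : ℤ, 1 ≤ x → ∀ (i : Fin m) (y : ℤ), K (x, i) (x + y, i) = ξ i y)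
    (hint : ∀ i, Summable fun y : ℤ => |(y : ℝ)| * (ξ i y).toReal)
    (hmean : ∀ i, ∑' y : ℤ, (y : ℝ) * (ξ i y).toReal = 0)
    (hsq : ∀ i, Summable fun y : ℤ => (y : ℝ) ^ 2 * (ξ i y).toReal)
    (hvar : ∀ i, (v i) ^ 2 = ∑' y : ℤ, (y : ℝ) ^ 2 * (ξ i y).toReal)
    (harith : ∀ i, ∀ n : ℕ, 1 ≤ n →
      (∀ y : ℤ, ξ i y ≠ 0 → (n : ℤ) ∣ y) → n = 1)
    -- (A2): from a non-positive radius the chain jumps to `ℕ × {1,…,m}` a.s.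
    (hA2 : ∀ x : ℤ, x ≤ 0 → ∀ i : Fin m, ∀ s' : ℤ × Fin m,
      K (x, i) s' ≠ 0 → 1 ≤ s'.1)
    -- (A3): `E[R(1) | 𝒳(0) = (x,i)] ≤ C (1 + |x|)` for `x ≤ 0`
    (C : ℝ) (hC : 0 < C)
    (hA3 : ∀ x : ℤ, x ≤ 0 → ∀ i : Fin m,
      ∑' s' : ℤ × Fin m, (s'.1.toNat : ℝ≥0∞) * K (x, i) s' ≤
        ENNReal.ofReal (C * (1 + |(x : ℝ)|)))
    -- (A4): the states `ℕ × {1,…,m}` communicate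
    (hA4 : ∀ s s' : ℤ × Fin m, 1 ≤ s.1 → 1 ≤ s'.1 → ∃ n : ℕ, iterK K n s s' ≠ 0)
    (πexit πent : Measure (ℤ × Fin m))
    (hπexit : ExitStationary P πexit) (hπent : EntranceStationary P πent) :
    ∀ A : Set (ℤ × Fin m),
      (∑' s : ℤ × Fin m, πent {s} * P s {ω | ω (sigmaT 0 ω) ∈ A} = πexit A) ∧
      (∑' s : ℤ × Fin m, πexit {s} * P s {ω | ω 1 ∈ A} = πent A) := by

  classical
  have : Inhabited (ℤ × Fin m) := ⟨(0, ⟨0, hm⟩)⟩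
  have hnev : ∀ s, ∀ᵐ ω ∂(P s), ω ∉ ⋂ n, stay (negS m) n := fun s =>
    compl_mem_ae_iff.2 (by
      rw [never_zero m K P hprob hcyl ξ v hv hA1 hint hmean hvar s])
  set N := negS m with hN
  have F1 : ∀ s A, P s {ω | ω (sigmaT 0 ω) ∈ A} = P s (exitEv N A Set.univ) := by
    intro s A
    apply measure_congr
    filter_upwards [hnev s] with ω hω
    obtain ⟨n, h1, h2⟩ := exists_first ω hω
    apply propext
    change ω (sigmaT 0 ω) ∈ A ↔ ω ∈ exitEv N A Set.univ
    rw [sigma0_eq ω n h1 h2, mem_exitEv_iff ω n h1 h2]; simp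
  have F2 : ∀ s A, P s {ω | ω (sigmaT 0 ω + 1) ∈ A} = P s (exitEv N Set.univ A) := by
    intro s A
    apply measure_congr
    filter_upwards [hnev s] with ω hω
    obtain ⟨n, h1, h2⟩ := exists_first ω hω
    apply propext
    change ω (sigmaT 0 ω + 1) ∈ A ↔ ω ∈ exitEv N Set.univ A
    rw [sigma0_eq ω n h1 h2, mem_exitEv_iff ω n h1 h2]; simp
  have F3 : ∀ s A, s ∈ N → P s {ω | ω (sigmaT 1 ω) ∈ A} =
      ∑' t, K s t * P t (exitEv N A Set.univ) := by
    intro s A hs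
    rw [← markov_shift K P hprob hcyl s _ (exitEv_meas _ _ _)]
    have hz : P s (shiftT ⁻¹' (⋂ n, stay N n)) = 0 := by
      rw [markov_shift K P hprob hcyl s _ (MeasurableSet.iInter fun n => stay_meas _ _)]
      simp [hN, never_zero m K P hprob hcyl ξ v hv hA1 hint hmean hvar]
    apply measure_congr
    filter_upwards [start_ae K P hprob hcyl s, compl_mem_ae_iff.2 hz] with ω hω hω'
    obtain ⟨n, h1, h2⟩ := exists_first (shiftT ω) hω'
    apply propext
    change ω (sigmaT 1 ω) ∈ A ↔ shiftT ω ∈ exitEv N A Set.univ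
    rw [sigma1_eq ω n (by rwa [hω]) h1 h2, mem_exitEv_iff _ n h1 h2]
    simp [shiftT]
  obtain ⟨he1, he2, he3⟩ := hπexit
  obtain ⟨hn1, hn2, hn3⟩ := hπent
  set q : ℤ × Fin m → ℤ × Fin m → ℝ≥0∞ := fun s u => P s (exitEv N {u} Set.univ) with hq
  set F : ℤ × Fin m → ℤ × Fin m → ℝ≥0∞ := fun s u => ∑' t, K s t * q t u with hFdef
  set ρ : ℤ × Fin m → ℝ≥0∞ := fun u => ∑' s, πent {s} * q s u with hρ
  have hF2 : ∀ s A, P s (exitEv N Set.univ A) = ∑' u, q s u * P u {ω | ω 1 ∈ A} := by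
    intro s A
    rw [exitEv_split P N Set.univ A s]
    congr 1; ext u
    rw [Set.indicator_of_mem (Set.mem_univ u), exitEv_markov K P hprob hcyl]
  have hq1 : ∀ s, ∑' u, q s u = 1 := by
    intro s
    have h := exitEv_split P N Set.univ Set.univ s
    simp only [Set.indicator_univ] at h
    rw [← h, ← F1]
    simpa using (hprob s).measure_univ
  have hF1 : ∀ s, ∑' u, F s u = 1 := by
    intro s
    simp only [hFdef]
    rw [ENNReal.tsum_comm]
    simp [ENNReal.tsum_mul_left, hq1, (K s).tsum_coe]
  have hsumm : ∀ μ : Measure (ℤ × Fin m), ∀ A, μ A = ∑' s, A.indicator (fun s => μ {s}) s := by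
    intro μ A
    rw [Measure.tsum_indicator_apply_singleton μ A MeasurableSet.of_discrete]
  have hmass : ∀ μ : Measure (ℤ × Fin m), IsProbabilityMeasure μ → ∑' s, μ {s} = 1 := by
    intro μ hμ
    have := hsumm μ Set.univ
    simpa using this.symm
  have hqN : ∀ s u, q s u ≠ 0 → u ∈ N := by
    intro s u h
    by_contra hu
    apply h
    have : exitEv N {u} Set.univ = ∅ := by
      ext ω
      simp only [exitEv, Set.mem_iUnion, mem_firstEx, Set.mem_singleton_iff,
        Set.mem_empty_iff_false, iff_false]
      rintro ⟨n, -, h2, rfl, -⟩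
      exact hu h2
    simp only [hq, this, measure_empty]
  have hpart2 : ∀ A, ∑' u, ρ u * P u {ω | ω 1 ∈ A} = πent A := by
    intro A
    rw [← hn3 A]
    simp only [F2, hF2, hρ, ← ENNReal.tsum_mul_left, ← ENNReal.tsum_mul_right]
    rw [ENNReal.tsum_comm]
    simp only [mul_assoc]
  have hρK : ∀ t, ∑' u, ρ u * K u t = πent {t} := by
    intro t
    rw [← hpart2 {t}]
    congr 1; ext u
    simp only [Set.mem_singleton_iff]
    rw [one_step_single K P hprob hcyl]
  have hexists : ∀ f : ℤ × Fin m → ℝ≥0∞, ∑' t, f t = 1 → ∃ t, f t ≠ 0 := by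
    intro f hf
    by_contra! hc
    simp [hc] at hf
  have hqstep : ∀ s u, s ∉ N → q s u = ∑' t, K s t * q t u := fun s u hs =>
    exitEv_first_step K P hprob hcyl N {u} s hs
  have hclosed : ∀ A : Set (ℤ × Fin m), (∀ s ∈ A, ∀ u, F s u ≠ 0 → u ∈ A) →
      ∀ t, (∀ u, q t u ≠ 0 → u ∈ A) → ∀ t', K t t' ≠ 0 → ∀ u, q t' u ≠ 0 → u ∈ A := by
    intro A hA t ht t' htt u hu
    have hne : ∑' t', K t t' * q t' u ≠ 0 := by
      intro h0
      rw [ENNReal.tsum_eq_zero] at h0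
      exact mul_ne_zero htt hu (h0 t')
    by_cases htN : t ∈ N
    · have htA : t ∈ A := ht t (by
        simp only [hq]; rw [exitEv_start K P hprob hcyl N t htN]; exact one_ne_zero)
      exact hA t htA u hne
    · exact ht u (by rw [hqstep t u htN]; exact hne)
  have hclosedn : ∀ A : Set (ℤ × Fin m), (∀ s ∈ A, ∀ u, F s u ≠ 0 → u ∈ A) →
      ∀ t, (∀ u, q t u ≠ 0 → u ∈ A) → ∀ n t', iterK K n t t' ≠ 0 → ∀ u, q t' u ≠ 0 → u ∈ A := by
    intro A hA t ht n
    induction n with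
    | zero =>
      intro t' h
      have : t' = t := by
        by_contra hc
        apply h
        simp [iterK, hc]
      rwa [this]
    | succ n ih =>
      intro t' h
      have h' : t' ∈ ((iterK K n t).bind K).support := h
      rw [PMF.mem_support_bind_iff] at h'
      obtain ⟨r, hr1, hr2⟩ := h'
      exact hclosed A hA r (ih r hr1) t' hr2
  have hpos : ∀ A : Set (ℤ × Fin m), A.Nonempty → (∀ s ∈ A, ∀ u, F s u ≠ 0 → u ∈ A) →
      ∃ t : ℤ × Fin m, 1 ≤ t.1 ∧ ∀ u, q t u ≠ 0 → u ∈ A := by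
    rintro A ⟨s, hs⟩ hA
    obtain ⟨u, hu⟩ := hexists _ (hF1 s)
    have huA := hA s hs u hu
    have huN : u ∈ N := by
      by_contra hc
      apply hu
      simp only [hFdef]
      rw [ENNReal.tsum_eq_zero]
      intro t
      by_contra h
      exact hc (hqN t u (right_ne_zero_of_mul h))
    obtain ⟨t, ht⟩ := hexists _ (K u).tsum_coe
    refine ⟨t, hA2 u.1 huN u.2 t ht, fun r hr => hA u huA r ?_⟩
    intro h0
    simp only [hFdef] at h0
    rw [ENNReal.tsum_eq_zero] at h0
    exact mul_ne_zero ht hr (h0 t)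
  have hρa : ρ = fun s => πexit {s} := by
    apply stat_unique F hF1
    · intro A B hAne hBne hA hB
      obtain ⟨t, ht1, ht⟩ := hpos A hAne hA
      obtain ⟨t', ht1', ht'⟩ := hpos B hBne hB
      obtain ⟨n, hn⟩ := hA4 t t' ht1 ht1'
      obtain ⟨u, hu⟩ := hexists _ (hq1 t')
      exact ⟨u, hclosedn A hA t ht n t' hn u hu, ht' u hu⟩
    · simp only [hρ]
      rw [ENNReal.tsum_comm]
      simp only [ENNReal.tsum_mul_left, hq1, mul_one]
      exact hmass _ hn1
    · exact hmass _ he1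
    · intro u
      trans ∑' t, (∑' s, ρ s * K s t) * q t u
      · simp only [hFdef, ← ENNReal.tsum_mul_left, ← ENNReal.tsum_mul_right]
        rw [ENNReal.tsum_comm]
        simp only [mul_assoc]
      · simp only [hρK]; rfl
    · intro u
      rw [← he3 {u}]
      congr 1; ext s
      by_cases hs : s ∈ N
      · rw [F3 s {u} hs]
      · have : πexit {s} = 0 := measure_mono_null (by
          intro s' hs'
          rw [Set.mem_singleton_iff] at hs'
          subst hs'
          have : ¬ (s'.1 ≤ 0) := hs
          exact (by omega : 1 ≤ s'.1)) he2
        rw [this]; simp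
  intro A
  constructor
  · rw [hsumm πexit A]
    have : ∀ s, πexit {s} = ρ s := fun s => by rw [hρa]
    simp only [this, F1]
    trans ∑' s, ∑' u, πent {s} * A.indicator (fun u => q s u) u
    · congr 1; ext s
      rw [exitEv_split P N A Set.univ s, ENNReal.tsum_mul_left]
    · rw [ENNReal.tsum_comm]
      congr 1; ext u
      by_cases hu : u ∈ A
      · simp [hu, hρ]
      · simp [hu]
  · rw [← hpart2 A, hρa]
end

section
/- Define μ := E_{π_entrance}[R(0)/v_{l(0)}] − E_{π_exit}[R(0)/v_{l(0)}]. Then μ = E_{π_exit}[R(1)/v_{l(1)} − R(0)/v_{l(0)}] = E_{π_entrance}[R(0)/v_{l(0)} − R(σ_1)/v_{l(σ_1)}] = E_{π_entrance}[(R(0) − R(σ_1))/v_{l(0)}], and μ ∈ (0, ∞). -/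
open MeasureTheory Filter
open scoped ENNReal

/-- prepend a state to a path -/
def consP {α : Type*} (s : α) (ω : ℕ → α) : ℕ → α
  | 0 => s
  | n + 1 => ω n

/-- cylinder sets -/
def cylSets (α : Type*) : Set (Set (ℕ → α)) :=
  {A | ∃ (n : ℕ) (path : ℕ → α), A = {ω | ∀ k ≤ n, ω k = path k}}

lemma measurable_consP {α : Type*} [MeasurableSpace α] (s : α) : Measurable (consP s) := by
  rw [measurable_pi_iff]
  intro n
  cases n with
  | zero => exact measurable_const
  | succ n => exact measurable_pi_apply n

lemma cyl_isPi (α : Type*) : IsPiSystem (cylSets α) := by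
  have key : ∀ (n n' : ℕ) (p p' : ℕ → α), n ≤ n' →
      ({ω | ∀ k ≤ n, ω k = p k} ∩ {ω : ℕ → α | ∀ k ≤ n', ω k = p' k}).Nonempty →
      {ω | ∀ k ≤ n, ω k = p k} ∩ {ω : ℕ → α | ∀ k ≤ n', ω k = p' k} =
        {ω : ℕ → α | ∀ k ≤ n', ω k = p' k} := by
    rintro n n' p p' hn ⟨ω₀, h1, h2⟩
    apply Set.inter_eq_right.2
    intro ω hω k hk
    rw [hω k (hk.trans hn), ← h2 k (hk.trans hn), h1 k hk]
  rintro _ ⟨n, p, rfl⟩ _ ⟨n', p', rfl⟩ hne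
  rcases le_total n n' with h | h
  · exact ⟨n', p', key n n' p p' h hne⟩
  · rw [Set.inter_comm] at hne ⊢
    exact ⟨n, p, key n' n p' p h hne⟩

lemma cyl_gen (α : Type*) [MeasurableSpace α] [Countable α] [MeasurableSingletonClass α] :
    (MeasurableSpace.pi : MeasurableSpace (ℕ → α)) = MeasurableSpace.generateFrom (cylSets α) := by
  apply le_antisymm
  · apply iSup_le
    intro k
    rw [← measurable_iff_comap_le]
    refine @measurable_to_countable' _ _ _ _ (_) _ ?_
    intro a
    have : (fun ω : ℕ → α => ω k) ⁻¹' {a} =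
        ⋃ p : {p : Fin (k+1) → α // p (Fin.last k) = a},
          {ω | ∀ j ≤ k, ω j = if h : j < k + 1 then p.1 ⟨j, h⟩ else a} := by
      ext ω
      simp only [Set.mem_preimage, Set.mem_singleton_iff, Set.mem_iUnion, Set.mem_ofPred_eq]
      constructor
      · intro h
        refine ⟨⟨fun j => ω j, by simpa using h⟩, fun j hj => ?_⟩
        simp [Nat.lt_succ_of_le hj]
      · rintro ⟨⟨p, hp⟩, h⟩
        have := h k le_rfl
        simp only [lt_add_iff_pos_right, zero_lt_one, dite_true] at this
        rw [this, ← hp]; rfl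
    rw [this]
    refine MeasurableSet.iUnion fun p => ?_
    exact MeasurableSpace.measurableSet_generateFrom ⟨k, _, rfl⟩
  · apply MeasurableSpace.generateFrom_le
    rintro _ ⟨n, p, rfl⟩
    have : {ω : ℕ → α | ∀ k ≤ n, ω k = p k} = ⋂ k ∈ Set.Iic n, (fun ω => ω k) ⁻¹' {p k} := by
      ext; simp
    rw [this]
    exact MeasurableSet.biInter (Set.to_countable _)
      fun k _ => measurable_pi_apply k (measurableSet_singleton _)

/-- the hypothesis that `P s` is the law of the chain started at `s` -/
def IsChainLaw {α : Type*} [DecidableEq α] [MeasurableSpace α] (K : α → PMF α)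
    (P : α → Measure (ℕ → α)) : Prop :=
  ∀ (s : α) (n : ℕ) (path : ℕ → α),
      P s {ω | ∀ k ≤ n, ω k = path k} =
        (if path 0 = s then 1 else 0) *
          ∏ k ∈ Finset.range n, K (path k) (path (k + 1))

section
variable {α : Type*} [DecidableEq α] [MeasurableSpace α] [Countable α]
  [MeasurableSingletonClass α] {K : α → PMF α} {P : α → Measure (ℕ → α)}

lemma markov_eq (hP : ∀ s, IsProbabilityMeasure (P s)) (h : IsChainLaw K P) (s : α) :
    P s = Measure.sum (fun t => K s t • (P t).map (consP s)) := by
  have hr : ∀ A, MeasurableSet A → Measure.sum (fun t => K s t • (P t).map (consP s)) A =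
      ∑' t, K s t * P t (consP s ⁻¹' A) := by
    intro A hA
    rw [Measure.sum_apply _ hA]
    simp [Measure.map_apply (measurable_consP s) hA]
  refine ext_of_generate_finite (cylSets α) (cyl_gen α) (cyl_isPi α) ?_ ?_
  · rintro A hA
    have hAm : MeasurableSet A := by
      rw [cyl_gen α]; exact MeasurableSpace.measurableSet_generateFrom hA
    rw [hr A hAm]
    obtain ⟨n, p, rfl⟩ := hA
    rw [h s n p]
    by_cases hp : p 0 = s
    swap
    · have : consP s ⁻¹' {ω | ∀ k ≤ n, ω k = p k} = ∅ := by
        ext ω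
        simp only [Set.mem_preimage, Set.mem_ofPred_eq, Set.mem_empty_iff_false, iff_false]
        intro h'
        exact hp (h' 0 (Nat.zero_le _)).symm
      simp [this, hp]
    cases n with
    | zero =>
      have : consP s ⁻¹' {ω | ∀ k ≤ 0, ω k = p k} = Set.univ := by
        ext ω
        simp [consP, hp]
      simp only [this, measure_univ, mul_one, (K s).tsum_coe]
      simp [hp]
    | succ n =>
      have : consP s ⁻¹' {ω | ∀ k ≤ n + 1, ω k = p k} = {ω | ∀ k ≤ n, ω k = p (k + 1)} := by
        ext ω
        simp only [Set.mem_preimage, Set.mem_ofPred_eq]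
        constructor
        · intro h' k hk
          exact h' (k+1) (by omega)
        · intro h' k hk
          cases k with
          | zero => exact hp.symm
          | succ k => exact h' k (by omega)
      simp only [this]
      have h2 : ∀ t, P t {ω | ∀ k ≤ n, ω k = p (k + 1)} = _ := fun t => h t n (fun k => p (k+1))
      simp only [h2]
      rw [tsum_eq_single (p 1)]
      · simp only [hp, Finset.prod_range_succ']
        simp [mul_comm]
      · intro t ht
        simp [Ne.symm ht]
  · rw [hr _ MeasurableSet.univ]
    simp [(K s).tsum_coe]

lemma markov_apply (hP : ∀ s, IsProbabilityMeasure (P s)) (h : IsChainLaw K P) (s : α)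
    {A : Set (ℕ → α)} (hA : MeasurableSet A) :
    P s A = ∑' t, K s t * P t (consP s ⁻¹' A) := by
  conv_lhs => rw [markov_eq hP h s]
  rw [Measure.sum_apply _ hA]
  simp [Measure.map_apply (measurable_consP s) hA]

lemma chain_zero (hP : ∀ s, IsProbabilityMeasure (P s)) (h : IsChainLaw K P) (s : α) :
    ∀ᵐ ω ∂(P s), ω 0 = s := by
  have := h s 0 (fun _ => s)
  simp only [nonpos_iff_eq_zero, forall_eq, if_true, Finset.range_zero, Finset.prod_empty,
    mul_one] at this
  change {ω | ω 0 = s} ∈ ae (P s)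
  rw [mem_ae_iff, prob_compl_eq_zero_iff]
  · exact this
  · exact (measurable_pi_apply (X := fun _ : ℕ => α) 0) (measurableSet_singleton s)

lemma chain_one (hP : ∀ s, IsProbabilityMeasure (P s)) (h : IsChainLaw K P) (s u : α) :
    P s {ω | ω 1 = u} = K s u := by
  change P s ((fun ω => ω 1) ⁻¹' {u}) = _
  rw [markov_apply hP h s (measurable_pi_apply 1 (measurableSet_singleton u))]
  have : ∀ t, P t (consP s ⁻¹' ((fun ω => ω 1) ⁻¹' {u})) = if u = t then 1 else 0 := by
    intro t
    have h0 := h t 0 (fun _ => u)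
    simp only [nonpos_iff_eq_zero, forall_eq, Finset.range_zero, Finset.prod_empty,
      mul_one] at h0
    rw [← h0]
    rfl
  rw [tsum_eq_single u]
  · rw [this]; simp
  · intro t ht; rw [this]; simp [Ne.symm ht]

end

/-- expected value of `f` at the exit time, on the event that this time is `n` -/
noncomputable def Tn {m : ℕ} (K : ℤ × Fin m → PMF (ℤ × Fin m)) (f : ℤ × Fin m → ℝ≥0∞) :
    ℕ → ℤ × Fin m → ℝ≥0∞
  | 0, s => if s.1 ≤ 0 then f s else 0
  | n + 1, s => if s.1 ≤ 0 then 0 else ∑' t, K s t * Tn K f n t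

/-- expected value of `f` at the exit time -/
noncomputable def Hit {m : ℕ} (K : ℤ × Fin m → PMF (ℤ × Fin m)) (f : ℤ × Fin m → ℝ≥0∞)
    (s : ℤ × Fin m) : ℝ≥0∞ := ∑' n, Tn K f n s

def ExitAt {m : ℕ} (n : ℕ) (A : Set (ℕ → ℤ × Fin m)) : Set (ℕ → ℤ × Fin m) :=
  {ω | (∀ k < n, 1 ≤ (ω k).1) ∧ (ω n).1 ≤ 0 ∧ (fun k => ω (n + k)) ∈ A}

lemma measurable_exitAt {m : ℕ} (n : ℕ) {A : Set (ℕ → ℤ × Fin m)} (hA : MeasurableSet A) :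
    MeasurableSet (ExitAt n A) := by
  have h1 : ∀ k, MeasurableSet {ω : ℕ → ℤ × Fin m | 1 ≤ (ω k).1} := fun k =>
    (measurable_pi_apply (X := fun _ : ℕ => ℤ × Fin m) k)
      (MeasurableSet.of_discrete (s := {s : ℤ × Fin m | 1 ≤ s.1}))
  have h2 : ∀ k, MeasurableSet {ω : ℕ → ℤ × Fin m | (ω k).1 ≤ 0} := fun k =>
    (measurable_pi_apply (X := fun _ : ℕ => ℤ × Fin m) k)
      (MeasurableSet.of_discrete (s := {s : ℤ × Fin m | s.1 ≤ 0}))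
  have h3 : Measurable (fun (ω : ℕ → ℤ × Fin m) (k : ℕ) => ω (n + k)) :=
    measurable_pi_iff.2 fun k => measurable_pi_apply _
  have : ExitAt n A = (⋂ k ∈ Set.Iio n, {ω : ℕ → ℤ × Fin m | 1 ≤ (ω k).1}) ∩
      ({ω | (ω n).1 ≤ 0} ∩ (fun (ω : ℕ → ℤ × Fin m) (k : ℕ) => ω (n + k)) ⁻¹' A) := by
    ext; simp [ExitAt]
  rw [this]
  exact (MeasurableSet.biInter (Set.to_countable _) fun k _ => h1 k).inter ((h2 n).inter (h3 hA))

section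
variable {m : ℕ} {K : ℤ × Fin m → PMF (ℤ × Fin m)} {P : ℤ × Fin m → Measure (ℕ → ℤ × Fin m)}

lemma prob_exitAt (hP : ∀ s, IsProbabilityMeasure (P s)) (h : IsChainLaw K P)
    {A : Set (ℕ → ℤ × Fin m)} (hA : MeasurableSet A) (n : ℕ) :
    ∀ s, P s (ExitAt n A) = Tn K (fun t => P t A) n s := by
  induction n with
  | zero =>
    intro s
    simp only [Tn]
    split_ifs with hs
    · apply measure_congr
      filter_upwards [chain_zero hP h s] with ω hω
      apply propext
      change ω ∈ ExitAt 0 A ↔ ω ∈ A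
      simp [ExitAt, hω, hs]
    · have : ∀ᵐ ω ∂(P s), ω ∉ ExitAt 0 A := by
        filter_upwards [chain_zero hP h s] with ω hω
        simp [ExitAt, hω, not_le.1 hs]
      exact measure_eq_zero_iff_ae_notMem.2 this
  | succ n ih =>
    intro s
    simp only [Tn]
    split_ifs with hs
    · have : ∀ᵐ ω ∂(P s), ω ∉ ExitAt (n+1) A := by
        filter_upwards [chain_zero hP h s] with ω hω hmem
        have := hmem.1 0 (Nat.succ_pos _)
        rw [hω] at this
        omega
      exact measure_eq_zero_iff_ae_notMem.2 this
    · rw [markov_apply hP h s (measurable_exitAt _ hA)]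
      congr 1; ext t; rw [← ih t]
      congr 2
      ext ω
      simp only [ExitAt, Set.mem_preimage, Set.mem_ofPred_eq]
      have e : (fun k => consP s ω (n + 1 + k)) = fun k => ω (n + k) := by
        ext1 k
        rw [show n + 1 + k = (n + k) + 1 by ring]; rfl
      rw [e]
      refine and_congr ?_ Iff.rfl
      constructor
      · intro h' k hk; exact h' (k+1) (by omega)
      · intro h' k hk
        cases k with
        | zero => change 1 ≤ s.1; omega
        | succ k => exact h' k (by omega)

lemma Tn_lin (f : ℤ × Fin m → ℝ≥0∞) (n : ℕ) :
    ∀ s, Tn K f n s = ∑' t, Tn K (fun u => if u = t then 1 else 0) n s * f t := by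
  induction n with
  | zero =>
    intro s
    simp only [Tn]
    split_ifs with hs
    · rw [tsum_eq_single s]
      · simp
      · intro t ht; simp [Ne.symm ht]
    · simp
  | succ n ih =>
    intro s
    simp only [Tn]
    split_ifs with hs
    · simp
    · simp_rw [ih, ← ENNReal.tsum_mul_left, ← ENNReal.tsum_mul_right]
      rw [ENNReal.tsum_comm]
      simp_rw [mul_assoc]

lemma Hit_lin (f : ℤ × Fin m → ℝ≥0∞) (s : ℤ × Fin m) :
    Hit K f s = ∑' t, Hit K (fun u => if u = t then 1 else 0) s * f t := by
  simp only [Hit, ← ENNReal.tsum_mul_right]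
  rw [ENNReal.tsum_comm]
  congr 1; ext n; exact Tn_lin f n s

lemma Hit_nonpos (f : ℤ × Fin m → ℝ≥0∞) (s : ℤ × Fin m) (hs : s.1 ≤ 0) :
    Hit K f s = f s := by
  rw [Hit, tsum_eq_single 0]
  · simp [Tn, hs]
  · intro n hn
    obtain ⟨k, rfl⟩ := Nat.exists_eq_succ_of_ne_zero hn
    simp [Tn, hs]

lemma Hit_pos (f : ℤ × Fin m → ℝ≥0∞) (s : ℤ × Fin m) (hs : 1 ≤ s.1) :
    Hit K f s = ∑' t, K s t * Hit K f t := by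
  have hs' : ¬ s.1 ≤ 0 := by omega
  rw [Hit, tsum_eq_zero_add' ENNReal.summable]
  simp only [Tn, hs', if_false, zero_add, Hit, ← ENNReal.tsum_mul_left]
  rw [ENNReal.tsum_comm]

lemma Hit_le (f w : ℤ × Fin m → ℝ≥0∞) (h0 : ∀ s, s.1 ≤ 0 → f s ≤ w s)
    (h1 : ∀ s, 1 ≤ s.1 → ∑' t, K s t * w t ≤ w s) (s : ℤ × Fin m) : Hit K f s ≤ w s := by
  have : ∀ N s, ∑ n ∈ Finset.range N, Tn K f n s ≤ w s := by
    intro N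
    induction N with
    | zero => intro s; simp
    | succ N ih =>
      intro s
      rw [Finset.sum_range_succ']
      by_cases hs : s.1 ≤ 0
      · simpa [Tn, hs] using h0 s hs
      · simp only [Tn, hs, if_false, add_zero]
        refine le_trans ?_ (h1 s (by omega))
        rw [← Summable.tsum_finsetSum (fun _ _ => ENNReal.summable)]
        refine ENNReal.tsum_le_tsum fun t => ?_
        rw [← Finset.mul_sum]
        exact mul_le_mul_right (ih t) _
  rw [Hit, ENNReal.tsum_eq_iSup_nat]
  exact iSup_le fun N => this N s

end
/-- mean size of the overshoot below `0` in one step from `x` -/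
noncomputable def ovs (ξ : PMF ℤ) (x : ℤ) : ℝ≥0∞ := ∑' y : ℤ, ξ y * ((-(x + y)).toNat : ℝ≥0∞)

structure GoodStep (ξ : PMF ℤ) : Prop where
  int : Summable fun y : ℤ => |(y : ℝ)| * (ξ y).toReal
  mean : ∑' y : ℤ, (y : ℝ) * (ξ y).toReal = 0
  sq : Summable fun y : ℤ => (y : ℝ) ^ 2 * (ξ y).toReal
  var : 0 < ∑' y : ℤ, (y : ℝ) ^ 2 * (ξ y).toReal

section
variable {ξ : PMF ℤ}

lemma GoodStep.sq_fin (h : GoodStep ξ) : ∑' y : ℤ, ξ y * ((y.natAbs ^ 2 : ℕ) : ℝ≥0∞) ≠ ⊤ := by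
  have h1 := (ENNReal.tsum_coe_ne_top_iff_summable_coe
    (f := fun y : ℤ => ((y.natAbs ^ 2 : ℕ) : NNReal) * (ξ y).toNNReal)).2 ?_
  · convert h1 using 3 with y
    rw [mul_comm]
    push_cast
    rw [ENNReal.coe_toNNReal (PMF.apply_ne_top ξ y)]
  · convert h.sq using 2 with y
    push_cast
    congr 1
    rw [Nat.cast_natAbs]; push_cast; exact sq_abs _

lemma GoodStep.abs_fin (h : GoodStep ξ) : ∑' y : ℤ, ξ y * (y.natAbs : ℝ≥0∞) ≠ ⊤ := by
  refine ne_top_of_le_ne_top h.sq_fin (ENNReal.tsum_le_tsum fun y => ?_)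
  gcongr
  nlinarith [Nat.le_self_pow (two_ne_zero) y.natAbs]

lemma GoodStep.neg_fin (h : GoodStep ξ) : ∑' y : ℤ, ξ y * ((-y).toNat : ℝ≥0∞) ≠ ⊤ := by
  refine ne_top_of_le_ne_top h.abs_fin (ENNReal.tsum_le_tsum fun y => ?_)
  gcongr
  omega

lemma GoodStep.pos_fin (h : GoodStep ξ) : ∑' y : ℤ, ξ y * (y.toNat : ℝ≥0∞) ≠ ⊤ := by
  refine ne_top_of_le_ne_top h.abs_fin (ENNReal.tsum_le_tsum fun y => ?_)
  gcongr
  omega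

lemma toNat_term_ne_top (ξ : PMF ℤ) (y : ℤ) (n : ℕ) : ξ y * (n : ℝ≥0∞) ≠ ⊤ :=
  ENNReal.mul_ne_top (PMF.apply_ne_top ξ y) (ENNReal.natCast_ne_top n)

lemma GoodStep.pos_eq_neg (h : GoodStep ξ) :
    ∑' y : ℤ, ξ y * (y.toNat : ℝ≥0∞) = ∑' y : ℤ, ξ y * ((-y).toNat : ℝ≥0∞) := by
  rw [← ENNReal.toReal_eq_toReal_iff' h.pos_fin h.neg_fin,
    ENNReal.tsum_toReal_eq (fun y => toNat_term_ne_top ξ y _),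
    ENNReal.tsum_toReal_eq (fun y => toNat_term_ne_top ξ y _), ← sub_eq_zero,
    ← Summable.tsum_sub (ENNReal.summable_toReal h.pos_fin) (ENNReal.summable_toReal h.neg_fin),
    ← h.mean]
  congr 1; ext y
  have : (y : ℝ) = (y.toNat : ℝ) - ((-y).toNat : ℝ) := by
    have : y = (y.toNat : ℤ) - ((-y).toNat : ℤ) := by omega
    exact_mod_cast this
  rw [this]
  simp; ring

lemma GoodStep.neg_ne_zero (h : GoodStep ξ) : ∑' y : ℤ, ξ y * ((-y).toNat : ℝ≥0∞) ≠ 0 := by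
  intro h0
  have h1 := h.pos_eq_neg
  rw [h0] at h1
  rw [ENNReal.tsum_eq_zero] at h0 h1
  have := h.var
  have hz : ∀ y : ℤ, (y : ℝ) ^ 2 * (ξ y).toReal = 0 := by
    intro y
    have a := h0 y
    have b := h1 y
    rw [mul_eq_zero] at a b
    rcases a with a | a
    · simp [a]
    rcases b with b | b
    · simp [b]
    have a' : (-y).toNat = 0 := by exact_mod_cast a
    have b' : y.toNat = 0 := by exact_mod_cast b
    have : y = 0 := by omega
    simp [this]
  simp [hz] at this

lemma GoodStep.exists_up (h : GoodStep ξ) : ∃ y : ℤ, 1 ≤ y ∧ ξ y ≠ 0 := by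
  have := h.neg_ne_zero
  rw [← h.pos_eq_neg, Ne, ENNReal.tsum_eq_zero] at this
  push Not at this
  obtain ⟨y, hy⟩ := this
  refine ⟨y, ?_, left_ne_zero_of_mul hy⟩
  have := right_ne_zero_of_mul hy
  have : y.toNat ≠ 0 := by exact_mod_cast this
  omega

lemma GoodStep.ovs_sum (h : GoodStep ξ) : ∑' n : ℕ, ovs ξ n ≠ ⊤ := by
  refine ne_top_of_le_ne_top h.sq_fin ?_
  simp only [ovs]
  rw [ENNReal.tsum_comm]
  refine ENNReal.tsum_le_tsum fun y => ?_
  rw [ENNReal.tsum_mul_left]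
  gcongr
  rw [tsum_eq_sum (s := Finset.range y.natAbs)]
  · calc ∑ n ∈ Finset.range y.natAbs, (((-((n : ℤ) + y)).toNat : ℕ) : ℝ≥0∞)
        ≤ ∑ n ∈ Finset.range y.natAbs, (y.natAbs : ℝ≥0∞) := by
          refine Finset.sum_le_sum fun n _ => ?_
          gcongr; omega
      _ = _ := by simp [pow_two]
  · intro n hn
    simp only [Finset.mem_range, not_lt] at hn
    have : (-((n : ℤ) + y)).toNat = 0 := by omega
    rw [this, Nat.cast_zero]

lemma GoodStep.ovs_fin (h : GoodStep ξ) (x : ℤ) (hx : 0 ≤ x) : ovs ξ x ≠ ⊤ := by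
  lift x to ℕ using hx
  exact ENNReal.ne_top_of_tsum_ne_top h.ovs_sum x

lemma step_min (h : GoodStep ξ) (x : ℤ) (hx : 1 ≤ x) (n : ℕ) :
    ∑' y : ℤ, ξ y * (min (x + y).toNat n : ℕ) +
      (if (n : ℤ) = x then ∑' y : ℤ, ξ y * ((-y).toNat : ℝ≥0∞) else 0) ≤
      (min x.toNat n : ℕ) + ovs ξ x := by
  have one : ∀ c : ℝ≥0∞, c = ∑' y : ℤ, ξ y * c := fun c => by
    rw [ENNReal.tsum_mul_right, ξ.tsum_coe, one_mul]
  rcases lt_trichotomy (n : ℤ) x with hn | hn | hn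
  · rw [if_neg hn.ne, add_zero]
    refine le_add_right ?_
    rw [one ((min x.toNat n : ℕ) : ℝ≥0∞)]
    refine ENNReal.tsum_le_tsum fun y => ?_
    refine mul_le_mul_right ?_ _
    norm_cast
    omega
  · rw [if_pos hn, one ((min x.toNat n : ℕ) : ℝ≥0∞), ovs, ← ENNReal.tsum_add, ← ENNReal.tsum_add]
    refine ENNReal.tsum_le_tsum fun y => ?_
    rw [← mul_add, ← mul_add]
    refine mul_le_mul_right ?_ _
    norm_cast
    omega
  · rw [if_neg hn.ne', add_zero]
    refine (ENNReal.add_le_add_iff_right h.neg_fin).1 ?_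
    conv_rhs => rw [← h.pos_eq_neg]
    rw [one ((min x.toNat n : ℕ) : ℝ≥0∞), ovs, ← ENNReal.tsum_add, ← ENNReal.tsum_add,
      ← ENNReal.tsum_add]
    refine ENNReal.tsum_le_tsum fun y => ?_
    rw [← mul_add, ← mul_add, ← mul_add]
    refine mul_le_mul_right ?_ _
    norm_cast
    omega

lemma lyap (h : GoodStep ξ) (ε : ℝ≥0∞) (hε : ε ≠ 0) :
    ∃ (w : ℤ → ℝ≥0∞) (L : ℝ≥0∞), L ≠ ⊤ ∧
      (∀ z : ℤ, w z ≤ L + ε * (z.toNat : ℝ≥0∞) + ((-z).toNat : ℝ≥0∞)) ∧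
      (∀ z : ℤ, ((-z).toNat : ℝ≥0∞) ≤ w z) ∧
      (∀ x : ℤ, 1 ≤ x → ∑' y : ℤ, ξ y * w (x + y) + ovs ξ x ≤ w x) := by
  set κ := ∑' y : ℤ, ξ y * ((-y).toNat : ℝ≥0∞) with hκ
  have hκ0 : κ ≠ 0 := h.neg_ne_zero
  have hκt : κ ≠ ⊤ := h.neg_fin
  set M : ℝ≥0∞ := 3 / κ with hM
  have hMκ : M * κ = 3 := ENNReal.div_mul_cancel hκ0 hκt
  have hMt : M ≠ ⊤ := ENNReal.div_ne_top (by norm_num) hκ0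
  -- choose N with small tail
  obtain ⟨N, hN⟩ : ∃ N : ℕ, M * ∑' n : ℕ, (if N ≤ n then ovs ξ n else 0) ≤ min 1 ε := by
    have ht := ENNReal.tendsto_sum_nat_add (fun n : ℕ => ovs ξ n) h.ovs_sum
    have ht' := ENNReal.Tendsto.const_mul (a := M) ht (Or.inr hMt)
    rw [mul_zero] at ht'
    have hpos : (0 : ℝ≥0∞) < min 1 ε := lt_min one_pos (pos_iff_ne_zero.2 hε)
    obtain ⟨N, hN⟩ := (ht'.eventually (gt_mem_nhds hpos)).exists
    refine ⟨N, le_trans (le_of_eq ?_) hN.le⟩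
    congr 1
    rw [← Summable.sum_add_tsum_nat_add' (f := fun n => if N ≤ n then ovs ξ n else 0) (k := N)
      ENNReal.summable]
    rw [Finset.sum_eq_zero, zero_add]
    · simp
    · intro n hn
      have := Finset.mem_range.1 hn
      simp [not_le.2 this]
  set a : ℕ → ℝ≥0∞ := fun n => if N ≤ n then ovs ξ n else 0 with ha
  set pr : ℤ → ℝ≥0∞ := fun x => ∑' y : ℤ, ξ y * (if 1 ≤ x + y then 0 else 1) with hpr
  set L : ℝ≥0∞ := ∑ n ∈ Finset.range N, (if pr n = 0 then 0 else 3 * ovs ξ n / pr n) with hL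
  have hLt : L ≠ ⊤ := by
    rw [hL]
    refine ENNReal.sum_ne_top.2 fun n _ => ?_
    split_ifs with h0
    · simp
    · exact ENNReal.div_ne_top (ENNReal.mul_ne_top (by norm_num) (h.ovs_fin n (by omega))) h0
  have hLpr : ∀ n : ℕ, n < N → 3 * ovs ξ n ≤ L * pr n := by
    intro n hn
    by_cases h0 : pr n = 0
    · have : ovs ξ n = 0 := by
        rw [ovs, ENNReal.tsum_eq_zero]
        rw [hpr, ENNReal.tsum_eq_zero] at h0
        intro y
        have := h0 y
        rw [mul_eq_zero] at this
        rcases this with h' | h'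
        · simp [h']
        · have : 1 ≤ (n : ℤ) + y := by by_contra hh; simp [hh] at h'
          have : (-((n : ℤ) + y)).toNat = 0 := by omega
          rw [this, Nat.cast_zero, mul_zero]
      simp [this]
    · have hprt : pr n ≠ ⊤ := by
        refine ne_top_of_le_ne_top (b := 1) (by simp) ?_
        rw [← ξ.tsum_coe]
        refine ENNReal.tsum_le_tsum fun y => ?_
        split_ifs <;> simp
      have : 3 * ovs ξ n / pr n ≤ L := by
        have := Finset.single_le_sum (f := fun n : ℕ => if pr n = 0 then 0 else 3 * ovs ξ n / pr n)
          (fun _ _ => zero_le) (Finset.mem_range.2 hn)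
        simpa [h0] using this
      calc 3 * ovs ξ n = 3 * ovs ξ n / pr n * pr n := (ENNReal.div_mul_cancel h0 hprt).symm
        _ ≤ _ := by gcongr
  set φ : ℤ → ℝ≥0∞ := fun z => M * ∑' n : ℕ, a n * (min z.toNat n : ℕ) with hφ
  have hφle : ∀ z : ℤ, φ z ≤ min 1 ε * (z.toNat : ℝ≥0∞) := by
    intro z
    calc φ z ≤ M * ∑' n : ℕ, a n * (z.toNat : ℝ≥0∞) := by
          refine mul_le_mul_right (ENNReal.tsum_le_tsum fun n => mul_le_mul_right ?_ _) _
          exact_mod_cast min_le_left _ _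
      _ = (M * ∑' n : ℕ, a n) * (z.toNat : ℝ≥0∞) := by rw [ENNReal.tsum_mul_right, mul_assoc]
      _ ≤ _ := by gcongr
  have hφstep : ∀ x : ℤ, 1 ≤ x →
      ∑' y : ℤ, ξ y * φ (x + y) + (if (N : ℤ) ≤ x then 3 * ovs ξ x else 0) ≤ φ x + ovs ξ x := by
    intro x hx
    have e1 : ∑' y : ℤ, ξ y * φ (x + y) =
        M * ∑' n : ℕ, a n * ∑' y : ℤ, ξ y * (min (x + y).toNat n : ℕ) := by
      simp only [hφ, ← ENNReal.tsum_mul_left]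
      rw [ENNReal.tsum_comm]
      congr 1; ext n; congr 1; ext y; ring
    have e2 : (if (N : ℤ) ≤ x then 3 * ovs ξ x else 0) =
        M * ∑' n : ℕ, a n * (if (n : ℤ) = x then κ else 0) := by
      lift x to ℕ using (by omega)
      rw [tsum_eq_single x]
      · simp only [ha, Nat.cast_le, if_true]
        split_ifs
        · rw [← hMκ]; ring
        · simp
      · intro n hn
        simp [hn]
    rw [e1, e2, ← mul_add, ← ENNReal.tsum_add]
    calc M * ∑' n : ℕ, (a n * ∑' y : ℤ, ξ y * (min (x + y).toNat n : ℕ) +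
            a n * (if (n : ℤ) = x then κ else 0))
        ≤ M * ∑' n : ℕ, (a n * (min x.toNat n : ℕ) + a n * ovs ξ x) := by
          refine mul_le_mul_right (ENNReal.tsum_le_tsum fun n => ?_) _
          rw [← mul_add, ← mul_add]
          refine mul_le_mul_right ?_ _
          exact step_min h x hx n
      _ = φ x + (M * ∑' n : ℕ, a n) * ovs ξ x := by
          rw [ENNReal.tsum_add, mul_add, ENNReal.tsum_mul_right, mul_assoc]
      _ ≤ φ x + 1 * ovs ξ x := by
          gcongr
          exact hN.trans (min_le_left _ _)
      _ = _ := by rw [one_mul]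
  refine ⟨fun z => (if 1 ≤ z then L else 0) + φ z + ((-z).toNat : ℝ≥0∞), L, hLt, ?_, ?_, ?_⟩
  · intro z
    dsimp only
    gcongr
    · split_ifs <;> simp
    · exact (hφle z).trans (by gcongr; exact min_le_right _ _)
  · intro z
    exact le_add_self
  · intro x hx
    dsimp only
    rw [if_pos hx]
    have hb : (3 : ℝ≥0∞) * ovs ξ x ≠ ⊤ := ENNReal.mul_ne_top (by norm_num) (h.ovs_fin x (by omega))
    have hz : (-x).toNat = 0 := by omega
    rw [hz, Nat.cast_zero, add_zero]
    have e1 : ∑' y : ℤ, ξ y * ((if 1 ≤ x + y then L else 0) + φ (x + y) +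
        ((-(x + y)).toNat : ℝ≥0∞)) = ∑' y : ℤ, ξ y * (if 1 ≤ x + y then L else 0) +
        ∑' y : ℤ, ξ y * φ (x + y) + ovs ξ x := by
      rw [ovs, ← ENNReal.tsum_add, ← ENNReal.tsum_add]
      congr 1; ext y; ring
    have e2 : ∑' y : ℤ, ξ y * (if 1 ≤ x + y then L else 0) + L * pr x = L := by
      rw [hpr, ← ENNReal.tsum_mul_left, ← ENNReal.tsum_add]
      calc _ = ∑' y : ℤ, ξ y * L := by
            congr 1; ext y
            split_ifs
            · simp
            · simp [mul_comm]
        _ = L := by rw [ENNReal.tsum_mul_right, ξ.tsum_coe, one_mul]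
    have e3 : 3 * ovs ξ x ≤ L * pr x + (if (N : ℤ) ≤ x then 3 * ovs ξ x else 0) := by
      split_ifs with hc
      · exact le_add_self
      · rw [add_zero]
        lift x to ℕ using (by omega)
        exact hLpr x (by omega)
    refine (ENNReal.add_le_add_iff_right hb).1 ?_
    rw [e1]
    calc _ ≤ ∑' y : ℤ, ξ y * (if 1 ≤ x + y then L else 0) +
        ∑' y : ℤ, ξ y * φ (x + y) + ovs ξ x + ovs ξ x +
          (L * pr x + (if (N : ℤ) ≤ x then 3 * ovs ξ x else 0)) := by gcongr
      _ = (∑' y : ℤ, ξ y * (if 1 ≤ x + y then L else 0) + L * pr x) +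
          (∑' y : ℤ, ξ y * φ (x + y) + (if (N : ℤ) ≤ x then 3 * ovs ξ x else 0)) +
          ovs ξ x + ovs ξ x := by ring
      _ ≤ L + (φ x + ovs ξ x) + ovs ξ x + ovs ξ x := by
          rw [e2]
          exact add_le_add_left (add_le_add_left (add_le_add_right (hφstep x hx) _) _) _
      _ = _ := by ring

/-- bounded harmonic functions of the killed walk vanish -/
lemma recur (h : GoodStep ξ) (q : ℤ → ℝ≥0∞) (q1 : ∀ z, q z ≤ 1) (q0 : ∀ z, z ≤ 0 → q z = 0)
    (hq : ∀ x : ℤ, 1 ≤ x → q x = ∑' y : ℤ, ξ y * q (x + y)) : ∀ z, q z = 0 := by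
  obtain ⟨w, L, hL, hw1, hw2, hw3⟩ := lyap h 1 one_ne_zero
  set V : ℤ → ℝ≥0∞ := fun z => (z.toNat : ℝ≥0∞) + w z with hV
  have hVt : ∀ z, V z ≠ ⊤ := fun z => ENNReal.add_ne_top.2 ⟨by simp,
    ne_top_of_le_ne_top (by simp [hL]) (hw1 z)⟩
  have hVs : ∀ x : ℤ, 1 ≤ x → ∑' y : ℤ, ξ y * V (x + y) ≤ V x := by
    intro x hx
    refine (ENNReal.add_le_add_iff_right h.neg_fin).1 ?_
    calc ∑' y : ℤ, ξ y * V (x + y) + ∑' y : ℤ, ξ y * ((-y).toNat : ℝ≥0∞)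
        ≤ ∑' y : ℤ, ξ y * (x.toNat : ℝ≥0∞) + ∑' y : ℤ, ξ y * (y.toNat : ℝ≥0∞) + ovs ξ x
          + ∑' y : ℤ, ξ y * w (x + y) := by
          rw [ovs, ← ENNReal.tsum_add, ← ENNReal.tsum_add, ← ENNReal.tsum_add, ← ENNReal.tsum_add]
          refine ENNReal.tsum_le_tsum fun y => ?_
          rw [hV, ← mul_add, ← mul_add, ← mul_add, ← mul_add]
          refine mul_le_mul_right ?_ _
          rw [add_right_comm]
          refine add_le_add_left ?_ _
          norm_cast
          omega
      _ = (x.toNat : ℝ≥0∞) + (∑' y : ℤ, ξ y * w (x + y) + ovs ξ x)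
          + ∑' y : ℤ, ξ y * ((-y).toNat : ℝ≥0∞) := by
          rw [ENNReal.tsum_mul_right, ξ.tsum_coe, one_mul, h.pos_eq_neg]; ring
      _ ≤ _ := by
          exact add_le_add_left (add_le_add_right (hw3 x hx) _) _
  intro x1
  by_contra hx1
  have hx1p : 1 ≤ x1 := by
    by_contra hc; exact hx1 (q0 x1 (by omega))
  -- real valued comparison
  set Q : ℤ → ℝ := fun z => (q z).toReal with hQ
  have hqt : ∀ z, q z ≠ ⊤ := fun z => ne_top_of_le_ne_top (by simp) (q1 z)
  have hQ1 : 0 < Q x1 := ENNReal.toReal_pos hx1 (hqt _)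
  set W : ℤ → ℝ := fun z => (V z).toReal with hW
  have hW0 : ∀ z, 0 ≤ W z := fun z => ENNReal.toReal_nonneg
  have hWz : ∀ z : ℤ, (z : ℝ) ≤ W z := by
    intro z
    have : ((z.toNat : ℝ≥0∞)).toReal ≤ (V z).toReal := ENNReal.toReal_mono (hVt z) le_self_add
    refine le_trans ?_ this
    simp only [ENNReal.toReal_natCast]
    exact_mod_cast Int.self_le_toNat z
  obtain ⟨η, hη, hηQ⟩ : ∃ η : ℝ, 0 < η ∧ η * W x1 < Q x1 := by
    refine ⟨Q x1 / (W x1 + 1), by have := hW0 x1; positivity, ?_⟩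
    have := hW0 x1
    rw [div_mul_eq_mul_div, div_lt_iff₀ (by linarith)]
    nlinarith
  set ψ : ℤ → ℝ := fun z => Q z - η * W z with hψ
  have hneg : ∀ z : ℤ, z ≤ 0 → ψ z ≤ 0 := by
    intro z hz
    have := hW0 z
    simp only [hψ, hQ, q0 z hz, ENNReal.toReal_zero]
    nlinarith
  obtain ⟨A, hA⟩ : ∃ A : ℕ, ∀ z : ℤ, (A : ℤ) < z → ψ z ≤ 0 := by
    obtain ⟨A, hA⟩ := exists_nat_gt (1 / η)
    refine ⟨A, fun z hz => ?_⟩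
    have h1 : Q z ≤ 1 := by
      have := ENNReal.toReal_mono (by simp) (q1 z); simpa using this
    have h2 : (A : ℝ) < z := by exact_mod_cast hz
    have h3 := hWz z
    rw [div_lt_iff₀ hη] at hA
    simp only [hψ]
    nlinarith
  -- largest maximizer
  have hψ1 : 0 < ψ x1 := by simp only [hψ]; linarith
  have hx1A : x1 ≤ A := by
    by_contra hc; have := hA x1 (by omega); linarith
  obtain ⟨x2, hx2m, hx2⟩ := (Finset.Icc (1 : ℤ) A).exists_max_image ψ
    ⟨x1, Finset.mem_Icc.2 ⟨hx1p, hx1A⟩⟩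
  have hψ2 : ψ x1 ≤ ψ x2 := hx2 x1 (Finset.mem_Icc.2 ⟨hx1p, hx1A⟩)
  have hmax : ∀ z, ψ z ≤ ψ x2 := by
    intro z
    by_cases h1 : z ≤ 0
    · linarith [hneg z h1]
    by_cases h2 : (A : ℤ) < z
    · linarith [hA z h2]
    exact hx2 z (Finset.mem_Icc.2 ⟨by omega, by omega⟩)
  obtain ⟨x0, hx0m, hx0⟩ := ((Finset.Icc (1 : ℤ) A).filter (fun z => ψ z = ψ x2)).exists_max_image id
    ⟨x2, Finset.mem_filter.2 ⟨hx2m, rfl⟩⟩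
  obtain ⟨hx0I, hx0e⟩ := Finset.mem_filter.1 hx0m
  have hx0p : 1 ≤ x0 := (Finset.mem_Icc.1 hx0I).1
  have hstrict : ∀ z, x0 < z → ψ z < ψ x0 := by
    intro z hz
    rw [hx0e]
    refine lt_of_le_of_ne (hmax z) fun he => ?_
    by_cases h2 : (A : ℤ) < z
    · linarith [hA z h2]
    have := hx0 z (Finset.mem_filter.2 ⟨Finset.mem_Icc.2 ⟨by omega, by omega⟩, he⟩)
    simp only [id] at this
    omega
  set E : ℝ≥0∞ := ENNReal.ofReal η with hE
  have hconv : ∀ z z', q z + E * V z' = ENNReal.ofReal (Q z + η * W z') := by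
    intro z z'
    rw [ENNReal.ofReal_add ENNReal.toReal_nonneg (mul_nonneg hη.le (hW0 _)),
      ENNReal.ofReal_mul hη.le, ENNReal.ofReal_toReal (hqt z), ENNReal.ofReal_toReal (hVt z')]
  have hle : ∀ z, q z + E * V x0 ≤ q x0 + E * V z := by
    intro z
    rw [hconv, hconv]
    apply ENNReal.ofReal_le_ofReal
    have := hmax z
    rw [← hx0e] at this
    simp only [hψ] at this
    linarith
  have hlt : ∀ z, x0 < z → q z + E * V x0 < q x0 + E * V z := by
    intro z hz
    rw [hconv, hconv]
    have := hstrict z hz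
    simp only [hψ] at this
    refine (ENNReal.ofReal_lt_ofReal_iff_of_nonneg ?_).2 (by linarith)
    exact add_nonneg ENNReal.toReal_nonneg (mul_nonneg hη.le (hW0 _))
  obtain ⟨y0, hy0, hy0'⟩ := h.exists_up
  have s1 : ∑' y : ℤ, ξ y * (q (x0 + y) + E * V x0) = q x0 + E * V x0 := by
    simp_rw [mul_add]
    rw [ENNReal.tsum_add, ← hq x0 hx0p, ENNReal.tsum_mul_right, ξ.tsum_coe, one_mul]
  have s2 : ∑' y : ℤ, ξ y * (q x0 + E * V (x0 + y)) ≤ q x0 + E * V x0 := by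
    simp_rw [mul_add]
    rw [ENNReal.tsum_add, ENNReal.tsum_mul_right, ξ.tsum_coe, one_mul]
    simp_rw [mul_left_comm _ E]
    rw [ENNReal.tsum_mul_left]
    gcongr
    exact hVs x0 hx0p
  have s3 : ∑' y : ℤ, ξ y * (q (x0 + y) + E * V x0) <
      ∑' y : ℤ, ξ y * (q x0 + E * V (x0 + y)) := by
    refine ENNReal.tsum_lt_tsum (i := y0) ?_ (fun y => ?_) ?_
    · rw [s1, hconv]; exact ENNReal.ofReal_ne_top
    · exact mul_le_mul_right (hle _) _
    · exact ENNReal.mul_lt_mul_right hy0' (PMF.apply_ne_top ξ _) (hlt _ (by omega))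
  rw [s1] at s3
  exact absurd (s3.trans_le s2) (lt_irrefl _)

end
lemma tsum_eq_of_le {α : Type*} {f g : α → ℝ≥0∞} (hle : ∀ a, f a ≤ g a)
    (hs : ∑' a, f a = ∑' a, g a) (ht : ∑' a, f a ≠ ⊤) : ∀ a, f a = g a := by
  intro a
  by_contra hne
  have := ENNReal.tsum_lt_tsum (i := a) ht hle (lt_of_le_of_ne (hle a) hne)
  exact this.ne hs

lemma unique_inv {α : Type*} (Q : α → α → ℝ≥0∞) (hQ : ∀ s, ∑' u, Q s u = 1)
    (p p' : α → ℝ≥0∞) (hp1 : ∑' s, p s = 1) (hp1' : ∑' s, p' s = 1)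
    (hp : ∀ u, ∑' s, p s * Q s u = p u) (hp' : ∀ u, ∑' s, p' s * Q s u = p' u)
    (irr : ∀ a a' : α → ℝ≥0∞, (∀ s, a s ≤ p s) → (∀ s, a' s ≤ p' s) →
      (∀ u, ∑' s, a s * Q s u = a u) → (∀ u, ∑' s, a' s * Q s u = a' u) →
      ∀ t, a' t ≠ 0 → ∀ s0, a s0 ≠ 0 → a' s0 ≠ 0) : ∀ s, p s = p' s := by
  set mm : α → ℝ≥0∞ := fun s => min (p s) (p' s) with hmm
  have hms : ∑' s, mm s ≤ 1 := by
    rw [← hp1]; exact ENNReal.tsum_le_tsum fun s => min_le_left _ _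
  have hmst : ∑' s, mm s ≠ ⊤ := ne_top_of_le_ne_top (by simp) hms
  have hmt : ∀ s, mm s ≠ ⊤ := fun s => ENNReal.ne_top_of_tsum_ne_top hmst s
  have hsum : ∑' u, ∑' s, mm s * Q s u = ∑' s, mm s := by
    rw [ENNReal.tsum_comm]
    simp_rw [ENNReal.tsum_mul_left, hQ, mul_one]
  have hminv : ∀ u, ∑' s, mm s * Q s u = mm u := by
    refine tsum_eq_of_le (fun u => ?_) hsum (by rw [hsum]; exact hmst)
    refine le_min ?_ ?_
    · rw [← hp u]
      exact ENNReal.tsum_le_tsum fun s => mul_le_mul_left (min_le_left _ _) _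
    · rw [← hp' u]
      exact ENNReal.tsum_le_tsum fun s => mul_le_mul_left (min_le_right _ _) _
  have hinv : ∀ r : α → ℝ≥0∞, (∀ s, mm s ≤ r s) → (∀ u, ∑' s, r s * Q s u = r u) →
      ∀ u, ∑' s, (r s - mm s) * Q s u = r u - mm u := by
    intro r hr hri u
    have e : ∑' s, (r s - mm s) * Q s u + mm u = r u - mm u + mm u := by
      rw [tsub_add_cancel_of_le (hr u)]
      conv_rhs => rw [← hri u]
      conv_lhs => rw [← hminv u]
      rw [← ENNReal.tsum_add]
      congr 1; ext s
      rw [← add_mul, tsub_add_cancel_of_le (hr s)]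
    exact (ENNReal.add_left_inj (hmt u)).1 e
  have hsub : ∀ r : α → ℝ≥0∞, (∀ s, mm s ≤ r s) → (∑' s, r s = 1) →
      ∑' s, (r s - mm s) + ∑' s, mm s = 1 := by
    intro r hr hr1
    rw [← ENNReal.tsum_add, ← hr1]
    congr 1; ext s
    rw [tsub_add_cancel_of_le (hr s)]
  have hl : ∀ s, mm s ≤ p s := fun s => min_le_left _ _
  have hl' : ∀ s, mm s ≤ p' s := fun s => min_le_right _ _
  have hmass : ∑' s, (p s - mm s) = ∑' s, (p' s - mm s) :=
    (ENNReal.add_left_inj hmst).1 ((hsub p hl hp1).trans (hsub p' hl' hp1').symm)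
  by_cases h0 : ∑' s, (p s - mm s) = 0
  · have h0' := h0
    rw [hmass] at h0'
    rw [ENNReal.tsum_eq_zero] at h0 h0'
    intro s
    have a := le_antisymm (tsub_eq_zero_iff_le.1 (h0 s)) (hl s)
    have b := le_antisymm (tsub_eq_zero_iff_le.1 (h0' s)) (hl' s)
    rw [a, b]
  · exfalso
    have h0' := h0
    rw [hmass] at h0'
    rw [ENNReal.tsum_eq_zero] at h0 h0'
    push Not at h0 h0'
    obtain ⟨s0, hs0⟩ := h0
    obtain ⟨t, ht⟩ := h0'
    have := irr (fun s => p s - mm s) (fun s => p' s - mm s) (fun s => tsub_le_self)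
      (fun s => tsub_le_self) (hinv p hl hp) (hinv p' hl' hp') t ht s0 hs0
    rcases le_total (p s0) (p' s0) with hc | hc
    · exact hs0 (by simp [hmm, hc])
    · exact this (by simp [hmm, hc])

lemma foster {α : Type*} (Q : α → α → ℝ≥0∞) (hQ : ∀ s, ∑' u, Q s u = 1)
    (p : α → ℝ≥0∞) (hp1 : ∑' s, p s = 1) (hp : ∀ u, ∑' s, p s * Q s u = p u)
    (V : α → ℝ≥0∞) (hV : ∀ s, V s ≠ ⊤) (B : ℝ≥0∞)
    (hd : ∀ s, p s ≠ 0 → ∑' u, Q s u * V u ≤ V s / 2 + B) : ∑' s, p s * (V s / 2) ≤ B := by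
  have key : ∀ N : ℝ≥0∞, N ≠ ⊤ → ∑' s, p s * (if V s ≤ N then V s / 2 else 0) ≤ B := by
    intro N hN
    have e : ∑' s, p s * min (V s) N = ∑' s, p s * ∑' u, Q s u * min (V u) N := by
      simp_rw [← ENNReal.tsum_mul_left]
      rw [ENNReal.tsum_comm]
      congr 1; ext u
      simp_rw [← mul_assoc]
      rw [ENNReal.tsum_mul_right, hp u]
    have hfin : ∑' s, p s * min (V s) N ≠ ⊤ := by
      refine ne_top_of_le_ne_top hN ?_
      calc _ ≤ ∑' s, p s * N := ENNReal.tsum_le_tsum fun s => mul_le_mul_right (min_le_right _ _) _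
        _ = N := by rw [ENNReal.tsum_mul_right, hp1, one_mul]
    refine (ENNReal.add_le_add_iff_right hfin).1 ?_
    nth_rewrite 1 [e]
    have eB : B = ∑' s, p s * B := by rw [ENNReal.tsum_mul_right, hp1, one_mul]
    rw [eB, ← ENNReal.tsum_add, ← ENNReal.tsum_add]
    refine ENNReal.tsum_le_tsum fun s => ?_
    rw [← mul_add, ← mul_add]
    by_cases hs : p s = 0
    · simp [hs]
    refine mul_le_mul_right ?_ _
    have h1 : ∑' u, Q s u * min (V u) N ≤ V s / 2 + B :=
      (ENNReal.tsum_le_tsum fun u => mul_le_mul_right (min_le_left _ _) _).trans (hd s hs)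
    have h2 : ∑' u, Q s u * min (V u) N ≤ N := by
      calc _ ≤ ∑' u, Q s u * N := ENNReal.tsum_le_tsum fun u => mul_le_mul_right (min_le_right _ _) _
        _ = N := by rw [ENNReal.tsum_mul_right, hQ, one_mul]
    split_ifs with hc
    · rw [min_eq_left hc]
      calc _ ≤ V s / 2 + (V s / 2 + B) := add_le_add_right h1 _
        _ = B + V s := by rw [← add_assoc, ENNReal.add_halves, add_comm]
    · rw [min_eq_right (not_le.1 hc).le, zero_add]
      exact h2.trans le_add_self
  rw [ENNReal.tsum_eq_iSup_sum]
  refine iSup_le fun F => ?_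
  refine le_trans ?_ (key (∑ s ∈ F, V s) (ENNReal.sum_ne_top.2 fun s _ => hV s))
  refine le_trans (le_of_eq ?_) (ENNReal.sum_le_tsum F)
  refine Finset.sum_congr rfl fun s hs => ?_
  rw [if_pos (Finset.single_le_sum (fun _ _ => zero_le) hs)]

section
variable {m : ℕ} {K : ℤ × Fin m → PMF (ℤ × Fin m)} {P : ℤ × Fin m → Measure (ℕ → ℤ × Fin m)}
  {ξ : Fin m → PMF ℤ}

/-- the property (A1) -/
def LineStep (K : ℤ × Fin m → PMF (ℤ × Fin m)) (ξ : Fin m → PMF ℤ) : Prop :=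
  ∀ x : ℤ, 1 ≤ x → ∀ (i : Fin m) (y : ℤ), K (x, i) (x + y, i) = ξ i y

lemma K_line (hA1 : LineStep K ξ) (x : ℤ) (hx : 1 ≤ x) (i : Fin m) (f : ℤ × Fin m → ℝ≥0∞) :
    ∑' t, K (x, i) t * f t = ∑' y : ℤ, ξ i y * f (x + y, i) := by
  have hinj : Function.Injective (fun y : ℤ => ((x + y, i) : ℤ × Fin m)) := by
    intro a b hab
    simpa using hab
  have hsupp : ∀ g : ℤ × Fin m → ℝ≥0∞, (∀ t, t.2 ≠ i → g t = 0) →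
      ∑' y : ℤ, g (x + y, i) = ∑' t, g t := by
    intro g hg
    refine hinj.tsum_eq (f := g) ?_
    intro t ht
    have : t.2 = i := by
      by_contra hc; exact ht (hg t hc)
    exact ⟨t.1 - x, by ext <;> simp [this]⟩
  have h1 : ∀ t, (if t.2 = i then K (x, i) t else 0) = K (x, i) t := by
    have hs : ∑' t : ℤ × Fin m, (if t.2 = i then K (x, i) t else 0) = 1 := by
      rw [← hsupp (fun t => if t.2 = i then K (x, i) t else 0) (fun t ht => if_neg ht)]
      simp only [if_true, hA1 x hx i, (ξ i).tsum_coe]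
    refine tsum_eq_of_le (fun t => ?_) ?_ ?_
    · split_ifs <;> simp
    · rw [hs, (K (x, i)).tsum_coe]
    · rw [hs]; simp
  rw [← hsupp (fun t => K (x, i) t * f t)]
  · simp only [hA1 x hx i]
  · intro t ht
    rw [← h1 t, if_neg ht, zero_mul]

lemma Hit_one (hA1 : LineStep K ξ) (hξ : ∀ i, GoodStep (ξ i)) (s : ℤ × Fin m) :
    Hit K (fun _ => 1) s = 1 := by
  have hle : ∀ s, Hit K (fun _ => 1) s ≤ 1 :=
    fun s => Hit_le (K := K) (fun _ => 1) (fun _ => 1) (fun _ _ => le_rfl)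
      (fun s _ => by simp [(K s).tsum_coe]) s
  have hq : ∀ i, ∀ z : ℤ, 1 - Hit K (fun _ => 1) (z, i) = 0 := by
    intro i
    refine recur (hξ i) (fun z => 1 - Hit K (fun _ => 1) (z, i)) (fun z => tsub_le_self) ?_ ?_
    · intro z hz
      rw [Hit_nonpos _ _ hz, tsub_self]
    · intro x hx
      have hh := Hit_pos (K := K) (fun _ => 1) (x, i) hx
      rw [K_line hA1 x hx] at hh
      have ht : ∑' y : ℤ, ξ i y * Hit K (fun _ => 1) (x + y, i) ≠ ⊤ := by
        rw [← hh]; exact ne_top_of_le_ne_top (by simp) (hle _)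
      refine (ENNReal.add_left_inj ht).1 ?_
      rw [← ENNReal.tsum_add]
      nth_rewrite 1 [← hh]
      rw [tsub_add_cancel_of_le (hle _)]
      rw [← (ξ i).tsum_coe]
      congr 1; ext y
      rw [← mul_add, (ξ i).tsum_coe, tsub_add_cancel_of_le (hle _), mul_one]
  exact le_antisymm (hle s) (tsub_eq_zero_iff_le.1 (hq s.2 s.1))

lemma Hit_label (hA1 : LineStep K ξ) (s u : ℤ × Fin m)
    (h : Hit K (fun t => if t = u then 1 else 0) s ≠ 0) : u.2 = s.2 := by
  by_contra hc
  have := Hit_le (K := K) (fun t => if t = u then 1 else 0) (fun t => if u.2 = t.2 then 1 else 0)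
    (fun t _ => by
      by_cases h : t = u
      · simp [h]
      · simp [h]) (fun t ht => by
      obtain ⟨x, i⟩ := t
      rw [K_line hA1 x ht i]
      refine le_of_eq ?_
      change ∑' y : ℤ, ξ i y * (if u.2 = i then (1 : ℝ≥0∞) else 0) = _
      by_cases hi : u.2 = i
      · simp [hi, (ξ i).tsum_coe]
      · simp [hi]) s
  simp only [hc, if_false] at this
  exact h (le_antisymm this zero_le)

lemma sigma_of_exit {n : ℕ} {A : Set (ℕ → ℤ × Fin m)} {ω : ℕ → ℤ × Fin m} (h : ω ∈ ExitAt n A) :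
    sigmaT 0 ω = n := by
  simp only [sigmaT]
  refine le_antisymm (Nat.sInf_le h.2.1) ?_
  refine le_csInf ⟨n, h.2.1⟩ ?_
  intro k hk
  by_contra hc
  have := h.1 k (not_le.1 hc)
  have hk' : (ω k).1 ≤ 0 := hk
  omega

lemma exit_disj (A : Set (ℕ → ℤ × Fin m)) :
    Pairwise (Function.onFun Disjoint fun n => ExitAt n A) := by
  intro n n' hn
  rw [Function.onFun, Set.disjoint_left]
  intro ω h1 h2
  exact hn ((sigma_of_exit h1).symm.trans (sigma_of_exit h2))

lemma prob_exit (hP : ∀ s, IsProbabilityMeasure (P s)) (h : IsChainLaw K P)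
    {A : Set (ℕ → ℤ × Fin m)} (hA : MeasurableSet A) (s : ℤ × Fin m) :
    P s (⋃ n, ExitAt n A) = Hit K (fun t => P t A) s := by
  rw [measure_iUnion (exit_disj A) (fun n => measurable_exitAt n hA), Hit]
  congr 1; ext n; exact prob_exitAt hP h hA n s

lemma ae_exit (hP : ∀ s, IsProbabilityMeasure (P s)) (h : IsChainLaw K P)
    (hA1 : LineStep K ξ) (hξ : ∀ i, GoodStep (ξ i)) (s : ℤ × Fin m) :
    ∀ᵐ ω ∂(P s), ω ∈ ⋃ n, ExitAt n (Set.univ : Set (ℕ → ℤ × Fin m)) := by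
  have := prob_exit hP h (MeasurableSet.univ) s
  simp only [measure_univ, Hit_one hA1 hξ] at this
  have hm : MeasurableSet (⋃ n, ExitAt n (Set.univ : Set (ℕ → ℤ × Fin m))) :=
    MeasurableSet.iUnion fun n => measurable_exitAt n MeasurableSet.univ
  rw [← prob_compl_eq_zero_iff hm] at this
  rw [ae_iff]
  exact this

lemma prob_shift (hP : ∀ s, IsProbabilityMeasure (P s)) (h : IsChainLaw K P)
    (hA1 : LineStep K ξ) (hξ : ∀ i, GoodStep (ξ i))
    {A : Set (ℕ → ℤ × Fin m)} (hA : MeasurableSet A) (s : ℤ × Fin m) :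
    P s {ω | (fun k => ω (sigmaT 0 ω + k)) ∈ A} = Hit K (fun t => P t A) s := by
  rw [← prob_exit hP h hA]
  apply measure_congr
  filter_upwards [ae_exit hP h hA1 hξ s] with ω hω
  apply propext
  change (fun k => ω (sigmaT 0 ω + k)) ∈ A ↔ ω ∈ ⋃ n, ExitAt n A
  obtain ⟨n, hn⟩ := Set.mem_iUnion.1 hω
  have hs := sigma_of_exit hn
  rw [Set.mem_iUnion, hs]
  constructor
  · intro hh; exact ⟨n, hn.1, hn.2.1, hh⟩
  · rintro ⟨n', hn'⟩
    have : n' = n := (sigma_of_exit hn').symm.trans hs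
    subst this
    exact hn'.2.2

lemma chain_zero_prob (h : IsChainLaw K P) (t u : ℤ × Fin m) :
    P t {ω | ω 0 = u} = if t = u then 1 else 0 := by
  have h0 := h t 0 (fun _ => u)
  simp only [nonpos_iff_eq_zero, forall_eq, Finset.range_zero, Finset.prod_empty,
      mul_one] at h0
  rw [h0]
  simp only [eq_comm]

lemma prob_at_exit (hP : ∀ s, IsProbabilityMeasure (P s)) (h : IsChainLaw K P)
    (hA1 : LineStep K ξ) (hξ : ∀ i, GoodStep (ξ i)) (s u : ℤ × Fin m) :
    P s {ω | ω (sigmaT 0 ω) = u} = Hit K (fun t => if t = u then 1 else 0) s := by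
  have := prob_shift hP h hA1 hξ (A := {ω | ω 0 = u})
    ((measurable_pi_apply (X := fun _ : ℕ => ℤ × Fin m) 0) (measurableSet_singleton u)) s
  simp only [chain_zero_prob h] at this
  exact this

lemma prob_after_exit (hP : ∀ s, IsProbabilityMeasure (P s)) (h : IsChainLaw K P)
    (hA1 : LineStep K ξ) (hξ : ∀ i, GoodStep (ξ i)) (s u : ℤ × Fin m) :
    P s {ω | ω (sigmaT 0 ω + 1) = u} = Hit K (fun t => K t u) s := by
  have := prob_shift hP h hA1 hξ (A := {ω | ω 1 = u})
    ((measurable_pi_apply (X := fun _ : ℕ => ℤ × Fin m) 1) (measurableSet_singleton u)) s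
  simp only [chain_one hP h] at this
  exact this

lemma measurable_at_exit : Measurable (fun ω : ℕ → ℤ × Fin m => ω (sigmaT 0 ω)) := by
  have hU : MeasurableSet (⋃ n, ExitAt n (Set.univ : Set (ℕ → ℤ × Fin m))) :=
    MeasurableSet.iUnion fun n => measurable_exitAt n MeasurableSet.univ
  have hev : ∀ (n : ℕ) (u : ℤ × Fin m), MeasurableSet {ω : ℕ → ℤ × Fin m | ω n = u} := fun n u =>
    (measurable_pi_apply (X := fun _ : ℕ => ℤ × Fin m) n) (measurableSet_singleton u)
  refine measurable_to_countable' fun u => ?_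
  have : (fun ω : ℕ → ℤ × Fin m => ω (sigmaT 0 ω)) ⁻¹' {u} =
      (⋃ n, (ExitAt n Set.univ ∩ {ω | ω n = u})) ∪
        ((⋃ n, ExitAt n (Set.univ : Set (ℕ → ℤ × Fin m)))ᶜ ∩ {ω | ω 0 = u}) := by
    ext ω
    by_cases hω : ∃ n, ω ∈ ExitAt n Set.univ
    · obtain ⟨n, hn⟩ := hω
      have hs := sigma_of_exit hn
      simp only [Set.mem_preimage, Set.mem_singleton_iff, hs, Set.mem_union, Set.mem_iUnion,
        Set.mem_inter_iff, Set.mem_ofPred_eq, Set.mem_compl_iff]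
      constructor
      · intro hh; exact Or.inl ⟨n, hn, hh⟩
      · rintro (⟨n', hn', hh⟩ | ⟨hh, _⟩)
        · have : n' = n := (sigma_of_exit hn').symm.trans hs
          rwa [this] at hh
        · exact absurd ⟨n, hn⟩ hh
    · have hs : sigmaT 0 ω = 0 := by
        simp only [sigmaT]
        rw [Nat.sInf_eq_zero]
        right
        by_contra hne
        have hne' := Set.nonempty_iff_ne_empty.2 hne
        refine hω ⟨_, fun k hk => ?_, Nat.sInf_mem hne', trivial⟩
        have := Nat.notMem_of_lt_sInf hk
        have : ¬ (ω k).1 ≤ 0 := this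
        omega
      push Not at hω
      simp [hs, hω]
  rw [this]
  exact (MeasurableSet.iUnion fun n =>
    (measurable_exitAt n MeasurableSet.univ).inter (hev n u)).union (hU.compl.inter (hev 0 u))

lemma lintegral_at_exit (hP : ∀ s, IsProbabilityMeasure (P s)) (h : IsChainLaw K P)
    (hA1 : LineStep K ξ) (hξ : ∀ i, GoodStep (ξ i)) (f : ℤ × Fin m → ℝ≥0∞) (s : ℤ × Fin m) :
    ∫⁻ ω, f (ω (sigmaT 0 ω)) ∂(P s) = Hit K f s := by
  rw [← lintegral_map (f := f) Measurable.of_discrete measurable_at_exit, lintegral_countable',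
    Hit_lin]
  congr 1; ext u
  rw [Measure.map_apply measurable_at_exit (measurableSet_singleton u), mul_comm,
    ← prob_at_exit hP h hA1 hξ]
  rfl

lemma lintegral_one (hP : ∀ s, IsProbabilityMeasure (P s)) (h : IsChainLaw K P)
    (f : ℤ × Fin m → ℝ≥0∞) (s : ℤ × Fin m) :
    ∫⁻ ω, f (ω 1) ∂(P s) = ∑' t, K s t * f t := by
  have hm : Measurable (fun ω : ℕ → ℤ × Fin m => ω 1) := measurable_pi_apply 1
  rw [← lintegral_map (f := f) Measurable.of_discrete hm, lintegral_countable']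
  congr 1; ext u
  rw [Measure.map_apply hm (measurableSet_singleton u), mul_comm, ← chain_one hP h]
  rfl

lemma ae_one (hP : ∀ s, IsProbabilityMeasure (P s)) (h : IsChainLaw K P) (s : ℤ × Fin m) :
    ∀ᵐ ω ∂(P s), K s (ω 1) ≠ 0 := by
  have : ∀ᵐ ω ∂(P s), ∀ t, K s t = 0 → ω 1 ≠ t := by
    rw [ae_all_iff]
    intro t
    by_cases ht : K s t = 0
    · rw [← chain_one hP h] at ht
      filter_upwards [measure_eq_zero_iff_ae_notMem.1 ht] with ω hω _
      exact hω
    · exact Eventually.of_forall fun ω hh => absurd hh ht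
  filter_upwards [this] with ω hω hh
  exact hω _ hh rfl

lemma ae_label (hP : ∀ s, IsProbabilityMeasure (P s)) (h : IsChainLaw K P)
    (hA1 : LineStep K ξ) (hξ : ∀ i, GoodStep (ξ i)) (s : ℤ × Fin m) :
    ∀ᵐ ω ∂(P s), (ω (sigmaT 0 ω)).2 = s.2 := by
  have : ∀ᵐ ω ∂(P s), ∀ t : ℤ × Fin m, t.2 ≠ s.2 → ω (sigmaT 0 ω) ≠ t := by
    rw [ae_all_iff]
    intro t
    by_cases ht : t.2 = s.2
    · exact Eventually.of_forall fun ω hh => absurd ht hh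
    · have h0 : P s {ω | ω (sigmaT 0 ω) = t} = 0 := by
        rw [prob_at_exit hP h hA1 hξ]
        by_contra hc
        exact ht (Hit_label hA1 s t hc)
      filter_upwards [measure_eq_zero_iff_ae_notMem.1 h0] with ω hω _
      exact hω
  filter_upwards [this] with ω hω
  by_contra hh
  exact hω _ hh rfl

lemma prob_second_exit (hP : ∀ s, IsProbabilityMeasure (P s)) (h : IsChainLaw K P)
    (hA1 : LineStep K ξ) (hξ : ∀ i, GoodStep (ξ i)) (s u : ℤ × Fin m) (hs : s.1 ≤ 0) :
    P s {ω | ω (sigmaT 1 ω) = u} =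
      ∑' t, K s t * Hit K (fun r => if r = u then 1 else 0) t := by
  have hsh : Measurable (fun (ω : ℕ → ℤ × Fin m) (k : ℕ) => ω (k + 1)) :=
    measurable_pi_iff.2 fun k => measurable_pi_apply _
  have hmark : ∀ A : Set (ℕ → ℤ × Fin m), MeasurableSet A →
      P s ((fun (ω : ℕ → ℤ × Fin m) (k : ℕ) => ω (k + 1)) ⁻¹' A) = ∑' t, K s t * P t A := by
    intro A hA
    rw [markov_apply hP h s (hsh hA)]
    rfl
  have hU : MeasurableSet (⋃ n, ExitAt n (Set.univ : Set (ℕ → ℤ × Fin m))) :=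
    MeasurableSet.iUnion fun n => measurable_exitAt n MeasurableSet.univ
  have hae : ∀ᵐ ω ∂(P s), (fun k => ω (k + 1)) ∈
      ⋃ n, ExitAt n (Set.univ : Set (ℕ → ℤ × Fin m)) := by
    have h0 := hmark _ hU.compl
    have h1 : ∀ t, P t (⋃ n, ExitAt n (Set.univ : Set (ℕ → ℤ × Fin m)))ᶜ = 0 :=
      fun t => ae_exit hP h hA1 hξ t
    simp only [h1, mul_zero, tsum_zero] at h0
    exact h0
  have hD : MeasurableSet {ω : ℕ → ℤ × Fin m | ω (sigmaT 0 ω) = u} :=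
    measurable_at_exit (measurableSet_singleton u)
  have h2 := hmark _ hD
  simp only [prob_at_exit hP h hA1 hξ] at h2
  rw [← h2]
  apply measure_congr
  filter_upwards [hae, chain_zero hP h s] with ω hω hω0
  apply propext
  obtain ⟨n, hn⟩ := Set.mem_iUnion.1 hω
  have hs0 := sigma_of_exit hn
  have e0 : sigmaT 0 ω = 0 := by
    simp only [sigmaT]
    rw [Nat.sInf_eq_zero]
    left
    change (ω 0).1 ≤ 0
    rw [hω0]; exact hs
  have e1 : sigmaT 1 ω = n + 1 := by
    have : sigmaT 1 ω = sInf {k : ℕ | sigmaT 0 ω < k ∧ (ω k).1 ≤ 0} := rfl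
    rw [this, e0]
    have hmem : (0 < n + 1 ∧ (ω (n + 1)).1 ≤ 0) := ⟨Nat.succ_pos _, hn.2.1⟩
    refine le_antisymm (Nat.sInf_le hmem) ?_
    refine le_csInf ⟨n + 1, hmem⟩ ?_
    rintro k ⟨hk1, hk2⟩
    by_contra hc
    obtain ⟨j, rfl⟩ := Nat.exists_eq_succ_of_ne_zero hk1.ne'
    have : 1 ≤ (ω (j + 1)).1 := hn.1 j (by omega)
    have hk2' : (ω (j + 1)).1 ≤ 0 := hk2
    omega
  change ω (sigmaT 1 ω) = u ↔ ω (sigmaT 0 (fun k => ω (k + 1)) + 1) = u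
  rw [e1, hs0]

end
section
variable {m : ℕ} {K : ℤ × Fin m → PMF (ℤ × Fin m)} {P : ℤ × Fin m → Measure (ℕ → ℤ × Fin m)}
  {ξ : Fin m → PMF ℤ}

lemma Hit_tsum (Q : ℤ × Fin m → ℤ × Fin m → ℝ≥0∞) (f : ℤ × Fin m → ℝ≥0∞) (s : ℤ × Fin m) :
    ∑' u, Hit K (fun t => Q t u) s * f u = Hit K (fun t => ∑' u, Q t u * f u) s := by
  rw [Hit_lin (K := K) (fun t => ∑' u, Q t u * f u)]
  simp_rw [← ENNReal.tsum_mul_left]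
  rw [ENNReal.tsum_comm]
  congr 1; ext u
  rw [Hit_lin (K := K) (fun t => Q t u), ← ENNReal.tsum_mul_right]
  simp_rw [mul_assoc]

lemma closed_iterK (N : Set (ℤ × Fin m)) (hN : ∀ s ∈ N, ∀ t, K s t ≠ 0 → t ∈ N)
    (s : ℤ × Fin m) (hs : s ∈ N) (n : ℕ) : ∀ t, iterK K n s t ≠ 0 → t ∈ N := by
  induction n with
  | zero =>
    intro t ht
    simp only [iterK, PMF.pure_apply] at ht
    have : t = s := by by_contra hc; simp [hc] at ht
    rwa [this]
  | succ n ih =>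
    intro t ht
    simp only [iterK, PMF.bind_apply, Ne, ENNReal.tsum_eq_zero] at ht
    push Not at ht
    obtain ⟨r, hr⟩ := ht
    exact hN r (ih r (left_ne_zero_of_mul hr)) t (right_ne_zero_of_mul hr)

/-- uniqueness of the stationary distribution of the entrance chain -/
lemma entrance_unique (hA1 : LineStep K ξ) (hξ : ∀ i, GoodStep (ξ i))
    (hA4 : ∀ s s' : ℤ × Fin m, 1 ≤ s.1 → 1 ≤ s'.1 → ∃ n : ℕ, iterK K n s s' ≠ 0)
    (p p' : ℤ × Fin m → ℝ≥0∞) (hp1 : ∑' s, p s = 1) (hp1' : ∑' s, p' s = 1)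
    (hps : ∀ s, p s ≠ 0 → 1 ≤ s.1) (hps' : ∀ s, p' s ≠ 0 → 1 ≤ s.1)
    (hp : ∀ u, ∑' s, p s * Hit K (fun t => K t u) s = p u)
    (hp' : ∀ u, ∑' s, p' s * Hit K (fun t => K t u) s = p' u) : ∀ s, p s = p' s := by
  refine unique_inv (fun s u => Hit K (fun t => K t u) s) ?_ p p' hp1 hp1' hp hp' ?_
  · intro s
    have := Hit_tsum (K := K) (fun t u => K t u) (fun _ => 1) s
    simp only [mul_one, PMF.tsum_coe, Hit_one hA1 hξ] at this
    exact this
  · intro a a' ha ha' hai hai' t ht s0 hs0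
    set N : Set (ℤ × Fin m) := {s | ∀ u, Hit K (fun t => K t u) s ≠ 0 → a' u ≠ 0} with hN
    have hZ : ∀ s, a' s ≠ 0 → s ∈ N := by
      intro s hs u hu
      rw [← hai' u, Ne, ENNReal.tsum_eq_zero]
      push Not
      exact ⟨s, mul_ne_zero hs hu⟩
    have hcl : ∀ s ∈ N, ∀ t, K s t ≠ 0 → t ∈ N := by
      intro s hs t ht
      by_cases h1 : s.1 ≤ 0
      · refine hZ t (hs t ?_)
        rw [Hit_nonpos _ _ h1]; exact ht
      · intro u hu
        refine hs u ?_
        rw [Hit_pos _ _ (by omega), Ne, ENNReal.tsum_eq_zero]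
        push Not
        exact ⟨t, mul_ne_zero ht hu⟩
    have hall : ∀ s : ℤ × Fin m, 1 ≤ s.1 → s ∈ N := by
      intro s hs
      have ht' : p' t ≠ 0 := fun h0 => ht (le_antisymm ((ha' t).trans h0.le) zero_le)
      obtain ⟨n, hn⟩ := hA4 t s (hps' t ht') hs
      exact closed_iterK N hcl t (hZ t ht) n s hn
    have h0 := hs0
    rw [← hai s0, Ne, ENNReal.tsum_eq_zero] at h0
    push Not at h0
    obtain ⟨s, hs⟩ := h0
    have hs' : p s ≠ 0 := fun h0 => left_ne_zero_of_mul hs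
      (le_antisymm ((ha s).trans h0.le) zero_le)
    exact hall s (hps s hs') s0 (right_ne_zero_of_mul hs)

lemma Hit_bound (hA1 : LineStep K ξ) (hξ : ∀ i, GoodStep (ξ i)) (ε : ℝ≥0∞) (hε : ε ≠ 0) :
    ∃ L : ℝ≥0∞, L ≠ ⊤ ∧ ∀ (c d : ℝ≥0∞) (f : ℤ × Fin m → ℝ≥0∞),
      (∀ s, s.1 ≤ 0 → f s ≤ c * (d + ((-s.1).toNat : ℝ≥0∞))) →
      ∀ s, 1 ≤ s.1 → Hit K f s ≤ c * (d + (L + ε * (s.1.toNat : ℝ≥0∞))) := by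
  choose w L hL hw1 hw2 hw3 using fun i => lyap (hξ i) ε hε
  refine ⟨∑ i, L i, ENNReal.sum_ne_top.2 fun i _ => hL i, fun c d f hf s hs => ?_⟩
  have := Hit_le (K := K) f (fun s => c * (d + w s.2 s.1))
    (fun s hs => (hf s hs).trans (mul_le_mul_right (add_le_add_right (hw2 _ _) _) _))
    (fun t ht => by
      obtain ⟨x, i⟩ := t
      rw [K_line hA1 x ht i]
      have h3 : ∑' y : ℤ, ξ i y * w i (x + y) ≤ w i x := le_self_add.trans (hw3 i x ht)
      calc ∑' y : ℤ, ξ i y * (c * (d + w i (x + y)))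
          = c * (d + ∑' y : ℤ, ξ i y * w i (x + y)) := by
            have : d = ∑' y : ℤ, ξ i y * d := by
              rw [ENNReal.tsum_mul_right, (ξ i).tsum_coe, one_mul]
            conv_rhs => rw [this]
            rw [← ENNReal.tsum_add, ← ENNReal.tsum_mul_left]
            congr 1; ext y; ring
        _ ≤ _ := mul_le_mul_right (add_le_add_right h3 _) _) s
  refine this.trans (mul_le_mul_right (add_le_add_right ?_ _) _)
  refine (hw1 s.2 s.1).trans ?_
  have hz : (-s.1).toNat = 0 := by omega
  rw [hz, Nat.cast_zero, add_zero]
  exact add_le_add_left (Finset.single_le_sum (fun _ _ => zero_le) (Finset.mem_univ s.2)) _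

end

/-- The drift constant `μ = E_{π_ent}[R(0)/v_{l(0)}] − E_{π_exit}[R(0)/v_{l(0)}]`
admits the alternative representations of Lemma 5.2 and lies in `(0,∞)`. -/
theorem stmt_3
    (m : ℕ) (hm : 1 ≤ m)
    (K : ℤ × Fin m → PMF (ℤ × Fin m))
    (P : ℤ × Fin m → Measure (ℕ → ℤ × Fin m))
    (hprob : ∀ s, IsProbabilityMeasure (P s))
    -- `P s` is the law of the Markov chain with kernel `K` started at `s`
    (hcyl : ∀ (s : ℤ × Fin m) (n : ℕ) (path : ℕ → ℤ × Fin m),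
      P s {ω | ∀ k ≤ n, ω k = path k} =
        (if path 0 = s then 1 else 0) *
          ∏ k ∈ Finset.range n, K (path k) (path (k + 1)))
    -- (A1): on `ℕ × {i}` the radius jumps like a centered square-integrable
    -- 1-arithmetic random walk with step distribution `ξ i`, variance `(v i)²`
    (ξ : Fin m → PMF ℤ) (v : Fin m → ℝ) (hv : ∀ i, 0 < v i)
    (hA1 : ∀ x : ℤ, 1 ≤ x → ∀ (i : Fin m) (y : ℤ), K (x, i) (x + y, i) = ξ i y)
    (hint : ∀ i, Summable fun y : ℤ => |(y : ℝ)| * (ξ i y).toReal)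
    (hmean : ∀ i, ∑' y : ℤ, (y : ℝ) * (ξ i y).toReal = 0)
    (hsq : ∀ i, Summable fun y : ℤ => (y : ℝ) ^ 2 * (ξ i y).toReal)
    (hvar : ∀ i, (v i) ^ 2 = ∑' y : ℤ, (y : ℝ) ^ 2 * (ξ i y).toReal)
    (harith : ∀ i, ∀ n : ℕ, 1 ≤ n →
      (∀ y : ℤ, ξ i y ≠ 0 → (n : ℤ) ∣ y) → n = 1)
    -- (A2): from a non-positive radius the chain jumps to `ℕ × {1,…,m}` a.s.
    (hA2 : ∀ x : ℤ, x ≤ 0 → ∀ i : Fin m, ∀ s' : ℤ × Fin m,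
      K (x, i) s' ≠ 0 → 1 ≤ s'.1)
    -- (A3): `E[R(1) | 𝒳(0) = (x,i)] ≤ C (1 + |x|)` for `x ≤ 0`
    (C : ℝ) (hC : 0 < C)
    (hA3 : ∀ x : ℤ, x ≤ 0 → ∀ i : Fin m,
      ∑' s' : ℤ × Fin m, (s'.1.toNat : ℝ≥0∞) * K (x, i) s' ≤
        ENNReal.ofReal (C * (1 + |(x : ℝ)|)))
    -- (A4): the states `ℕ × {1,…,m}` communicate
    (hA4 : ∀ s s' : ℤ × Fin m, 1 ≤ s.1 → 1 ≤ s'.1 → ∃ n : ℕ, iterK K n s s' ≠ 0)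
    (πexit πent : Measure (ℤ × Fin m))
    (hπexit : ExitStationary P πexit) (hπent : EntranceStationary P πent)
    (μ : ℝ)
    (hμ : μ = (∑' s : ℤ × Fin m, ((s.1 : ℝ) / v s.2) * (πent {s}).toReal) -
      (∑' s : ℤ × Fin m, ((s.1 : ℝ) / v s.2) * (πexit {s}).toReal)) :
    μ = ∑' s : ℤ × Fin m, (πexit {s}).toReal *
        ∫ ω, (((ω 1).1 : ℝ) / v (ω 1).2 - ((ω 0).1 : ℝ) / v (ω 0).2) ∂(P s) ∧
    μ = ∑' s : ℤ × Fin m, (πent {s}).toReal *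
        ∫ ω, (((ω 0).1 : ℝ) / v (ω 0).2 -
          ((ω (sigmaT 0 ω)).1 : ℝ) / v (ω (sigmaT 0 ω)).2) ∂(P s) ∧
    μ = ∑' s : ℤ × Fin m, (πent {s}).toReal *
        ∫ ω, (((ω 0).1 - (ω (sigmaT 0 ω)).1 : ℤ) : ℝ) / v (ω 0).2 ∂(P s) ∧
    0 < μ := by
  have hch : IsChainLaw K P := hcyl
  have hL : LineStep K ξ := hA1
  have hξ : ∀ i, GoodStep (ξ i) := fun i =>
    ⟨hint i, hmean i, hsq i, by rw [← hvar i]; have := hv i; positivity⟩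
  obtain ⟨hep, hes0, hest⟩ := hπexit
  obtain ⟨hpp, hps0, hpst⟩ := hπent
  set p : ℤ × Fin m → ℝ≥0∞ := fun s => πent {s} with hpdef
  set e : ℤ × Fin m → ℝ≥0∞ := fun s => πexit {s} with hedef
  have hmass : ∀ π : Measure (ℤ × Fin m), IsProbabilityMeasure π → ∑' s, π {s} = 1 := by
    intro π hπ
    have := lintegral_countable' (μ := π) (fun _ : ℤ × Fin m => (1 : ℝ≥0∞))
    simpa using this.symm
  have hp1 : ∑' s, p s = 1 := hmass πent hpp
  have he1 : ∑' s, e s = 1 := hmass πexit hep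
  have hpt : ∀ s, p s ≠ ⊤ := fun s => measure_ne_top _ _
  have het : ∀ s, e s ≠ ⊤ := fun s => measure_ne_top _ _
  have hps : ∀ s, p s ≠ 0 → 1 ≤ s.1 := by
    intro s hs
    by_contra hc
    refine hs (measure_mono_null ?_ hps0)
    intro t ht
    rw [Set.mem_singleton_iff.1 ht]
    change s.1 ≤ 0
    omega
  have hes : ∀ s, e s ≠ 0 → s.1 ≤ 0 := by
    intro s hs
    by_contra hc
    refine hs (measure_mono_null ?_ hes0)
    intro t ht
    rw [Set.mem_singleton_iff.1 ht]
    change 1 ≤ s.1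
    omega
  have hpinv : ∀ u, ∑' s, p s * Hit K (fun t => K t u) s = p u := by
    intro u
    rw [← show _ = p u from hpst {u}]
    congr 1; ext s
    rw [← prob_after_exit hprob hch hL hξ]
    rfl
  have heinv : ∀ u, ∑' s, e s * ∑' t, K s t * Hit K (fun r => if r = u then 1 else 0) t = e u := by
    intro u
    rw [← show _ = e u from hest {u}]
    congr 1; ext s
    by_cases hs : e s = 0
    · rw [hs]
      have hs' : πexit {s} = 0 := hs
      rw [hs', zero_mul, zero_mul]
    rw [← prob_second_exit hprob hch hL hξ s u (hes s hs)]
    rfl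
  set p' : ℤ × Fin m → ℝ≥0∞ := fun t => ∑' s, e s * K s t with hp'def
  have hp'f : ∀ f : ℤ × Fin m → ℝ≥0∞, ∑' t, p' t * f t = ∑' s, e s * ∑' t, K s t * f t := by
    intro f
    simp only [hp'def, ← ENNReal.tsum_mul_right, ← ENNReal.tsum_mul_left]
    rw [ENNReal.tsum_comm]
    simp_rw [mul_assoc]
  have hp'H : ∀ f : ℤ × Fin m → ℝ≥0∞, ∑' t, p' t * Hit K f t = ∑' u, e u * f u := by
    intro f
    simp_rw [fun t => Hit_lin (K := K) f t, ← ENNReal.tsum_mul_left]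
    rw [ENNReal.tsum_comm]
    congr 1; ext u
    simp_rw [← mul_assoc]
    rw [ENNReal.tsum_mul_right, hp'f, heinv]
  have hpp' : ∀ s, p s = p' s := by
    refine entrance_unique hL hξ hA4 p p' hp1 ?_ hps ?_ hpinv ?_
    · have := hp'f (fun _ => 1)
      simp only [mul_one, PMF.tsum_coe] at this
      rw [this, he1]
    · intro t ht
      simp only [hp'def, Ne, ENNReal.tsum_eq_zero] at ht
      push Not at ht
      obtain ⟨s, hs⟩ := ht
      exact hA2 s.1 (hes s (left_ne_zero_of_mul hs)) s.2 t (right_ne_zero_of_mul hs)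
    · intro u
      rw [hp'H]
  have hpf : ∀ f : ℤ × Fin m → ℝ≥0∞, ∑' t, p t * f t = ∑' s, e s * ∑' t, K s t * f t := by
    intro f; rw [← hp'f]; simp_rw [hpp']
  have hpH : ∀ f : ℤ × Fin m → ℝ≥0∞, ∑' t, p t * Hit K f t = ∑' u, e u * f u := by
    intro f; rw [← hp'H]; simp_rw [hpp']
  -- finiteness of the first moments
  set c : ℝ≥0∞ := ENNReal.ofReal C with hc
  have hc0 : c ≠ 0 := by simp [hc, hC]
  have hct : c ≠ ⊤ := ENNReal.ofReal_ne_top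
  set ε : ℝ≥0∞ := c⁻¹ / 2 with hεdef
  have hε : ε ≠ 0 := by
    simp [hεdef, ENNReal.div_eq_zero_iff, hct]
  have hεt : ε ≠ ⊤ := by
    exact ENNReal.div_ne_top (ENNReal.inv_ne_top.2 hc0) (by norm_num)
  have hcε : c * ε = 1 / 2 := by
    rw [hεdef, ← mul_div_assoc, ENNReal.mul_inv_cancel hc0 hct]
  obtain ⟨L, hLt, hLb⟩ := Hit_bound (K := K) hL hξ ε hε
  have hQ1 : ∀ s, ∑' u, Hit K (fun t => K t u) s = 1 := by
    intro s
    have := Hit_tsum (K := K) (fun t u => K t u) (fun _ => 1) s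
    simp only [mul_one, PMF.tsum_coe, Hit_one hL hξ] at this
    exact this
  have hA3' : ∀ s : ℤ × Fin m, s.1 ≤ 0 → ∑' u, K s u * (u.1.toNat : ℝ≥0∞) ≤
      c * (1 + ((-s.1).toNat : ℝ≥0∞)) := by
    intro s hs
    have h := hA3 s.1 hs s.2
    have e1 : ENNReal.ofReal (C * (1 + |(s.1 : ℝ)|)) = c * (1 + ((-s.1).toNat : ℝ≥0∞)) := by
      rw [ENNReal.ofReal_mul hC.le, ENNReal.ofReal_add zero_le_one (abs_nonneg _),
        ENNReal.ofReal_one]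
      congr 2
      rw [← ENNReal.ofReal_natCast]
      congr 1
      have : |s.1| = ((-s.1).toNat : ℤ) := by rw [abs_of_nonpos hs]; omega
      exact_mod_cast this
    rw [e1] at h
    simpa only [mul_comm] using h
  have hVfin : ∑' s : ℤ × Fin m, p s * (s.1.toNat : ℝ≥0∞) ≠ ⊤ := by
    have hB : c * (1 + L) ≠ ⊤ := ENNReal.mul_ne_top hct (by simp [hLt])
    have := foster (fun s u => Hit K (fun t => K t u) s) hQ1 p hp1 hpinv
      (fun s => (s.1.toNat : ℝ≥0∞)) (fun s => by simp) (c * (1 + L)) ?_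
    · simp only [div_eq_mul_inv, ← mul_assoc] at this
      rw [ENNReal.tsum_mul_right] at this
      intro htop
      rw [htop, ENNReal.top_mul (by simp)] at this
      exact hB (top_le_iff.1 this)
    · intro s hs
      rw [Hit_tsum (K := K) (fun t u => K t u) (fun u => (u.1.toNat : ℝ≥0∞))]
      refine (hLb c 1 _ hA3' s (hps s hs)).trans (le_of_eq ?_)
      calc c * (1 + (L + ε * (s.1.toNat : ℝ≥0∞)))
          = (c * ε) * (s.1.toNat : ℝ≥0∞) + c * (1 + L) := by ring
        _ = _ := by rw [hcε, one_div, div_eq_mul_inv, mul_comm (2 : ℝ≥0∞)⁻¹]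
  have hNfin : ∑' s : ℤ × Fin m, e s * ((-s.1).toNat : ℝ≥0∞) ≠ ⊤ := by
    rw [← hpH]
    have : ∑' t, p t * Hit K (fun s => ((-s.1).toNat : ℝ≥0∞)) t ≤
        L + ε * ∑' s : ℤ × Fin m, p s * (s.1.toNat : ℝ≥0∞) := by
      have eL : L = ∑' s, p s * L := by rw [ENNReal.tsum_mul_right, hp1, one_mul]
      conv_rhs => rw [eL]
      rw [← ENNReal.tsum_mul_left, ← ENNReal.tsum_add]
      refine ENNReal.tsum_le_tsum fun s => ?_
      by_cases hs : p s = 0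
      · simp [hs]
      have := hLb 1 0 (fun s => ((-s.1).toNat : ℝ≥0∞)) (fun s _ => by simp) s (hps s hs)
      rw [one_mul, zero_add] at this
      refine (mul_le_mul_right this _).trans (le_of_eq ?_)
      ring
    exact ne_top_of_le_ne_top (ENNReal.add_ne_top.2 ⟨hLt, ENNReal.mul_ne_top hεt hVfin⟩) this
  -- positive and negative parts
  set Fp : ℤ × Fin m → ℝ≥0∞ := fun s => ENNReal.ofReal ((s.1 : ℝ) / v s.2) with hFp
  set Fm : ℤ × Fin m → ℝ≥0∞ := fun s => ENNReal.ofReal (-((s.1 : ℝ) / v s.2)) with hFm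
  set cv : ℝ≥0∞ := ∑ i, ENNReal.ofReal (v i)⁻¹ with hcv
  have hcvt : cv ≠ ⊤ := ENNReal.sum_ne_top.2 fun i _ => ENNReal.ofReal_ne_top
  have hcvi : ∀ i, ENNReal.ofReal (v i)⁻¹ ≤ cv := fun i =>
    Finset.single_le_sum (f := fun i => ENNReal.ofReal (v i)⁻¹) (fun _ _ => zero_le)
      (Finset.mem_univ i)
  have hgen : ∀ (z : ℤ) (i : Fin m),
      ENNReal.ofReal ((z : ℝ) / v i) ≤ cv * (z.toNat : ℝ≥0∞) := by
    intro z i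
    have h1 : (z : ℝ) / v i ≤ (v i)⁻¹ * (z.toNat : ℝ) := by
      rw [div_eq_inv_mul]
      have : (z : ℝ) ≤ (z.toNat : ℝ) := by exact_mod_cast Int.self_le_toNat z
      exact mul_le_mul_of_nonneg_left this (inv_nonneg.2 (hv i).le)
    refine (ENNReal.ofReal_le_ofReal h1).trans ?_
    rw [ENNReal.ofReal_mul (inv_nonneg.2 (hv i).le), ENNReal.ofReal_natCast]
    exact mul_le_mul_left (hcvi i) _
  have hFple : ∀ s : ℤ × Fin m, Fp s ≤ cv * (s.1.toNat : ℝ≥0∞) := fun s => hgen s.1 s.2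
  have hFmle : ∀ s : ℤ × Fin m, Fm s ≤ cv * ((-s.1).toNat : ℝ≥0∞) := by
    intro s
    have := hgen (-s.1) s.2
    push_cast at this
    rw [neg_div] at this
    exact this
  have hpFp : ∑' s, p s * Fp s ≠ ⊤ := by
    refine ne_top_of_le_ne_top (ENNReal.mul_ne_top hcvt hVfin) ?_
    rw [← ENNReal.tsum_mul_left]
    refine ENNReal.tsum_le_tsum fun s => (mul_le_mul_right (hFple s) _).trans (le_of_eq ?_)
    ring
  have heFm : ∑' s, e s * Fm s ≠ ⊤ := by
    refine ne_top_of_le_ne_top (ENNReal.mul_ne_top hcvt hNfin) ?_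
    rw [← ENNReal.tsum_mul_left]
    refine ENNReal.tsum_le_tsum fun s => (mul_le_mul_right (hFmle s) _).trans (le_of_eq ?_)
    ring
  have hfp : ∀ s : ℤ × Fin m, 1 ≤ s.1 → 0 < (s.1 : ℝ) / v s.2 := by
    intro s hs
    have : (0 : ℝ) < s.1 := by exact_mod_cast (by omega : 0 < s.1)
    exact div_pos this (hv _)
  have hfm : ∀ s : ℤ × Fin m, s.1 ≤ 0 → (s.1 : ℝ) / v s.2 ≤ 0 := by
    intro s hs
    have : (s.1 : ℝ) ≤ 0 := by exact_mod_cast hs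
    exact div_nonpos_of_nonpos_of_nonneg this (hv _).le
  have hμ' : μ = (∑' s, p s * Fp s + ∑' s, e s * Fm s).toReal := by
    rw [hμ, ENNReal.toReal_add hpFp heFm, ENNReal.tsum_toReal_eq
      (fun s => ENNReal.ne_top_of_tsum_ne_top hpFp s), ENNReal.tsum_toReal_eq
      (fun s => ENNReal.ne_top_of_tsum_ne_top heFm s), sub_eq_add_neg, ← tsum_neg]
    congr 1
    · congr 1; ext s
      rw [ENNReal.toReal_mul]
      by_cases hs : p s = 0
      · have hs' : πent {s} = 0 := hs
        simp [hs, hs']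
      · rw [hFp, ENNReal.toReal_ofReal (hfp s (hps s hs)).le, mul_comm]
    · congr 1; ext s
      rw [ENNReal.toReal_mul]
      by_cases hs : e s = 0
      · have hs' : πexit {s} = 0 := hs
        simp [hs, hs']
      · rw [hFm, ENNReal.toReal_ofReal (neg_nonneg.2 (hfm s (hes s hs)))]
        ring
  have hof : ∀ s t : ℤ × Fin m, 1 ≤ s.1 → t.1 ≤ 0 →
      ENNReal.ofReal ((s.1 : ℝ) / v s.2 - (t.1 : ℝ) / v t.2) = Fp s + Fm t := by
    intro s t hs ht
    rw [sub_eq_add_neg, ENNReal.ofReal_add (hfp s hs).le (neg_nonneg.2 (hfm t ht))]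
  have hdisc : ∀ g : ℤ × Fin m → ℝ, Measurable g := fun g => Measurable.of_discrete
  have hm0 : Measurable (fun ω : ℕ → ℤ × Fin m => ω 0) := measurable_pi_apply 0
  have hm1 : Measurable (fun ω : ℕ → ℤ × Fin m => ω 1) := measurable_pi_apply 1
  have hmf0 := (hdisc (fun s => (s.1 : ℝ) / v s.2)).comp hm0
  have hmf1 := (hdisc (fun s => (s.1 : ℝ) / v s.2)).comp hm1
  have hmfs := (hdisc (fun s => (s.1 : ℝ) / v s.2)).comp (measurable_at_exit (m := m))
  have I2 : ∀ s : ℤ × Fin m, 1 ≤ s.1 → ∫ ω, (((ω 0).1 : ℝ) / v (ω 0).2 -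
      ((ω (sigmaT 0 ω)).1 : ℝ) / v (ω (sigmaT 0 ω)).2) ∂(P s) = (Fp s + Hit K Fm s).toReal := by
    intro s hs
    have hae : ∀ᵐ ω ∂(P s), ω 0 = s ∧ (ω (sigmaT 0 ω)).1 ≤ 0 := by
      filter_upwards [chain_zero hprob hch s, ae_exit hprob hch hL hξ s] with ω h0 h1
      obtain ⟨n, hn⟩ := Set.mem_iUnion.1 h1
      refine ⟨h0, ?_⟩
      rw [sigma_of_exit hn]
      exact hn.2.1
    rw [integral_eq_lintegral_of_nonneg_ae]
    · congr 1
      calc _ = ∫⁻ ω, (Fp s + Fm (ω (sigmaT 0 ω))) ∂(P s) := by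
            apply lintegral_congr_ae
            filter_upwards [hae] with ω hω
            rw [hof _ _ (by rw [hω.1]; exact hs) hω.2, hω.1]
        _ = _ := by
            rw [lintegral_add_left measurable_const, lintegral_at_exit hprob hch hL hξ]
            simp
    · filter_upwards [hae] with ω hω
      have h1 := hfp (ω 0) (by rw [hω.1]; exact hs)
      have h2 := hfm _ hω.2
      simp only [Pi.zero_apply]
      linarith
    · exact (hmf0.sub hmfs).aestronglyMeasurable
  have I1 : ∀ s : ℤ × Fin m, s.1 ≤ 0 → ∫ ω, (((ω 1).1 : ℝ) / v (ω 1).2 -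
      ((ω 0).1 : ℝ) / v (ω 0).2) ∂(P s) = (∑' t, K s t * Fp t + Fm s).toReal := by
    intro s hs
    have hae : ∀ᵐ ω ∂(P s), ω 0 = s ∧ 1 ≤ (ω 1).1 := by
      filter_upwards [chain_zero hprob hch s, ae_one hprob hch s] with ω h0 h1
      exact ⟨h0, hA2 s.1 hs s.2 _ h1⟩
    rw [integral_eq_lintegral_of_nonneg_ae]
    · congr 1
      calc _ = ∫⁻ ω, (Fp (ω 1) + Fm s) ∂(P s) := by
            apply lintegral_congr_ae
            filter_upwards [hae] with ω hω
            rw [hof _ _ hω.2 (by rw [hω.1]; exact hs), hω.1]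
        _ = _ := by
            rw [lintegral_add_right _ measurable_const, lintegral_one hprob hch]
            simp
    · filter_upwards [hae] with ω hω
      have h1 := hfm (ω 0) (by rw [hω.1]; exact hs)
      have h2 := hfp _ hω.2
      simp only [Pi.zero_apply]
      linarith
    · exact (hmf1.sub hmf0).aestronglyMeasurable
  have hsum2 : ∑' s, p s * (Fp s + Hit K Fm s) = ∑' s, p s * Fp s + ∑' s, e s * Fm s := by
    simp_rw [mul_add]
    rw [ENNReal.tsum_add, hpH]
  have hsum1 : ∑' s, e s * (∑' t, K s t * Fp t + Fm s) =
      ∑' s, p s * Fp s + ∑' s, e s * Fm s := by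
    simp_rw [mul_add]
    rw [ENNReal.tsum_add, hpf]
  have htot : ∑' s, p s * Fp s + ∑' s, e s * Fm s ≠ ⊤ := ENNReal.add_ne_top.2 ⟨hpFp, heFm⟩
  have hsum2t : ∑' s, p s * (Fp s + Hit K Fm s) ≠ ⊤ := by rw [hsum2]; exact htot
  have hsum1t : ∑' s, e s * (∑' t, K s t * Fp t + Fm s) ≠ ⊤ := by rw [hsum1]; exact htot
  have R2 : μ = ∑' s : ℤ × Fin m, (πent {s}).toReal *
        ∫ ω, (((ω 0).1 : ℝ) / v (ω 0).2 -
          ((ω (sigmaT 0 ω)).1 : ℝ) / v (ω (sigmaT 0 ω)).2) ∂(P s) := by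
    rw [hμ', ← hsum2, ENNReal.tsum_toReal_eq
      (fun s => ENNReal.ne_top_of_tsum_ne_top hsum2t s)]
    congr 1; ext s
    rw [ENNReal.toReal_mul]
    by_cases hs : p s = 0
    · have hs' : πent {s} = 0 := hs
      simp [hs, hs']
    · rw [I2 s (hps s hs)]
  refine ⟨?_, R2, ?_, ?_⟩
  · rw [hμ', ← hsum1, ENNReal.tsum_toReal_eq
      (fun s => ENNReal.ne_top_of_tsum_ne_top hsum1t s)]
    congr 1; ext s
    rw [ENNReal.toReal_mul]
    by_cases hs : e s = 0
    · have hs' : πexit {s} = 0 := hs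
      simp [hs, hs']
    · rw [I1 s (hes s hs)]
  · rw [R2]
    congr 1; ext s
    congr 1
    apply integral_congr_ae
    filter_upwards [chain_zero hprob hch s, ae_label hprob hch hL hξ s] with ω h0 h1
    rw [h1, h0]
    push_cast
    ring
  · rw [hμ']
    refine ENNReal.toReal_pos ?_ htot
    intro h0
    have h1 : ∑' s, p s * Fp s = 0 := (add_eq_zero.1 h0).1
    rw [ENNReal.tsum_eq_zero] at h1
    have h2 : ∀ s, p s = 0 := by
      intro s
      by_contra hs
      rcases mul_eq_zero.1 (h1 s) with h | h
      · exact hs h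
      · have := hfp s (hps s hs)
        rw [hFp] at h
        exact absurd (ENNReal.ofReal_eq_zero.1 h) (not_le.2 this)
    simp [h2] at hp1
end
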